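/- arXiv:2404.18342 — 5 statements merged into one kernel-verified Lean document; each statement's English description precedes it below -/
import Mathlib

section
/- Let n ∈ ℕ and m ∈ ℕ₀. There is a constant C = C(n,m) > 0 such that for every f ∈ L¹(ℝⁿ) there exists F ∈ W_m^{m+1,1}(ℝ₊^{n+1}) with F(·,t) → f in L¹(ℝⁿ) as t → 0⁺ and ‖F‖_{W_m^{m+1,1}(ℝ₊^{n+1})} ≤ C ‖f‖_{L¹(ℝⁿ)}. -/
open MeasureTheory Filter Set
open scoped ENNReal NNReal Topology

noncomputable section

abbrev En (n : ℕ) : Type := EuclideanSpace ℝ (Fin n)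

/-- The Gaussian kernel `W`. -/
def gaussW (n : ℕ) (x : En n) : ℝ :=
  Real.exp (-‖x‖ ^ 2 / 4) / (4 * Real.pi) ^ ((n : ℝ) / 2)

/-- The rescaled Gaussian kernel `W_t`. -/
def gaussWt (n : ℕ) (t : ℝ) (x : En n) : ℝ :=
  (t ^ n)⁻¹ * gaussW n (t⁻¹ • x)

/-- The rescaled Gauss–Weierstrass extension `u(x,t) = (W_t * f)(x)`. -/
def heatExt (n : ℕ) (f : En n → ℝ) (x : En n) (t : ℝ) : ℝ :=
  ∫ y, gaussWt n t (x - y) * f y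

/-- Iterated difference `Δ_h^k f`. -/
def iterDiff {n : ℕ} (h : En n) (k : ℕ) (f : En n → ℝ) : En n → ℝ :=
  (fun g (x : En n) => g (x + h) - g x)^[k] f

/-- Homogeneous Besov seminorm (p = 1) of order `0 < σ ≤ 1`. -/
def besovPiece (n : ℕ) (σ : ℝ) (f : En n → ℝ) : ℝ≥0∞ :=
  ∫⁻ h : En n, ∫⁻ x : En n,
    ENNReal.ofReal (|iterDiff h (⌊σ⌋₊ + 1) f x| / ‖h‖ ^ ((n : ℝ) + σ))

/-- `v` is the weak partial derivative of `u` on `ℝⁿ` in direction `e`. -/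
def IsWeakDerivRn (n : ℕ) (e : En n) (u v : En n → ℝ) : Prop :=
  ∀ φ : En n → ℝ, ContDiff ℝ (⊤ : ℕ∞) φ → HasCompactSupport φ →
    ∫ x, u x * fderiv ℝ φ x e = - ∫ x, v x * φ x

/-- `D` is a system of weak partial derivatives of `f` on `ℝⁿ` up to order `ℓ`. -/
def WeakDerivsUpTo (n ℓ : ℕ) (f : En n → ℝ)
    (D : (k : ℕ) → (Fin k → Fin n) → En n → ℝ) : Prop :=
  D 0 Fin.elim0 = f ∧
  ∀ k, k < ℓ → ∀ v : Fin (k + 1) → Fin n,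
    IsWeakDerivRn n (EuclideanSpace.single (v 0) 1) (D k (Fin.tail v)) (D (k + 1) v)

/-- The open upper half space `ℝⁿ × (0,∞)`. -/
def halfSpace (n : ℕ) : Set (En n × ℝ) := Set.univ ×ˢ Set.Ioi (0 : ℝ)

/-- Coordinate directions of `ℝⁿ × ℝ`. -/
def dirH (n : ℕ) (i : Fin (n + 1)) : En n × ℝ :=
  if h : (i : ℕ) < n then (EuclideanSpace.single ⟨i, h⟩ 1, 0) else (0, 1)

/-- `v` is the weak partial derivative of `u` on the half space in direction `e`. -/
def IsWeakDerivH (n : ℕ) (e : En n × ℝ) (u v : En n × ℝ → ℝ) : Prop :=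
  ∀ φ : En n × ℝ → ℝ, ContDiff ℝ (⊤ : ℕ∞) φ → HasCompactSupport φ →
    tsupport φ ⊆ halfSpace n →
    ∫ p, u p * fderiv ℝ φ p e = - ∫ p, v p * φ p

/-- `D` is a system of weak partial derivatives of `u` on the half space up to order `m+1`. -/
def WeakDerivsH (n m : ℕ) (u : En n × ℝ → ℝ)
    (D : (k : ℕ) → (Fin k → Fin (n + 1)) → En n × ℝ → ℝ) : Prop :=
  D 0 Fin.elim0 = u ∧
  ∀ k, k ≤ m → ∀ v : Fin (k + 1) → Fin (n + 1),
    IsWeakDerivH n (dirH n (v 0)) (D k (Fin.tail v)) (D (k + 1) v)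

/-- Weighted Sobolev norm `‖u‖_{W_a^{m+1,1}(ℝ₊^{n+1})}` computed from weak derivative data. -/
def wSobNorm (n m : ℕ) (a : ℝ)
    (D : (k : ℕ) → (Fin k → Fin (n + 1)) → En n × ℝ → ℝ) : ℝ≥0∞ :=
  ∑ j ∈ Finset.range (m + 2),
    ∫⁻ p in halfSpace n,
      ENNReal.ofReal (p.2 ^ a * Real.sqrt (∑ v : Fin j → Fin (n + 1), (D j v p) ^ 2))

/-- Inhomogeneous Besov norm `‖f‖_{B^{s,1}}`, `s = ℓ + σ`, from weak derivative data. -/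
def besovNormData (n ℓ : ℕ) (σ : ℝ)
    (D : (k : ℕ) → (Fin k → Fin n) → En n → ℝ) : ℝ≥0∞ :=
  (∑ j ∈ Finset.range (ℓ + 1), ∑ v : Fin j → Fin n, ∫⁻ x, ENNReal.ofReal |D j v x|)
    + ∑ v : Fin ℓ → Fin n, besovPiece n σ (D ℓ v)

/-- `F(·,t) → f` in `L¹(ℝⁿ)` as `t → 0⁺`. -/
def TraceL1 (n : ℕ) (F : En n × ℝ → ℝ) (f : En n → ℝ) : Prop :=
  Tendsto (fun t : ℝ => ∫⁻ x, ENNReal.ofReal |F (x, t) - f x|) (𝓝[>] 0) (𝓝 0)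

/-- Classical iterated directional derivative along a tuple of coordinate directions. -/
def cderivTuple (n : ℕ) : {k : ℕ} → (Fin k → Fin (n + 1)) → ((En n × ℝ) → ℝ) → (En n × ℝ) → ℝ
  | 0, _, g => g
  | _ + 1, v, g => fun p => fderiv ℝ (cderivTuple n (Fin.tail v) g) p (dirH n (v 0))

/-- First order partial derivative in the `i`-th coordinate on `ℝⁿ`. -/
def pd1 (n : ℕ) (i : Fin n) (g : En n → ℝ) : En n → ℝ :=
  fun x => fderiv ℝ g x (EuclideanSpace.single i 1)

/-- Multi-index partial derivative `∂^α` on `ℝⁿ`. -/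
def pdMulti (n : ℕ) (α : Fin n → ℕ) (g : En n → ℝ) : En n → ℝ :=
  (List.finRange n).foldr (fun i h => (pd1 n i)^[α i] h) g


/-- The tensor product `g(x) ψ(t / ε)`. -/
def tensorScale (n : ℕ) (g : En n → ℝ) (ψ : ℝ → ℝ) (ε : ℝ) : En n × ℝ → ℝ :=
  fun p => g p.1 * ψ (ε⁻¹ * p.2)

lemma fderiv_tensor_apply {n : ℕ} {G : En n → ℝ} {h : ℝ → ℝ} (hG : Differentiable ℝ G)
    (hh : Differentiable ℝ h) (a c : ℝ) (p e : En n × ℝ) :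
    fderiv ℝ (fun p : En n × ℝ => G p.1 * (a * h (c * p.2))) p e =
      fderiv ℝ G p.1 e.1 * (a * h (c * p.2)) +
        G p.1 * (a * (c * e.2 * deriv h (c * p.2))) := by
  have h1 : HasFDerivAt (fun p : En n × ℝ => G p.1) _ p :=
    (hG p.1).hasFDerivAt.comp p hasFDerivAt_fst
  have h2 : HasFDerivAt (fun p : En n × ℝ => c * p.2) _ p :=
    (hasFDerivAt_snd (𝕜 := ℝ) (p := p)).const_mul c
  have h3 : HasFDerivAt (fun p : En n × ℝ => h (c * p.2)) _ p :=
    (hh (c * p.2)).hasDerivAt.comp_hasFDerivAt p h2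
  have h4 : HasFDerivAt (fun p : En n × ℝ => G p.1 * (a * h (c * p.2))) _ p :=
    h1.mul (h3.const_mul a)
  rw [h4.fderiv]
  simp
  ring

/-- Iterated derivatives of `g(x) ψ(t / ε)` are again tensor products, with a factor in `x` that
does not depend on the scale. -/
lemma exists_cderivTuple_tensorScale (n : ℕ) {k : ℕ} (v : Fin k → Fin (n + 1)) {g : En n → ℝ}
    (hg : ContDiff ℝ (⊤ : ℕ∞) g) (hgc : HasCompactSupport g) :
    ∃ (G : En n → ℝ) (j : ℕ), ContDiff ℝ (⊤ : ℕ∞) G ∧ HasCompactSupport G ∧ j ≤ k ∧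
      (j = k → G = g) ∧ ∀ ψ : ℝ → ℝ, ContDiff ℝ (⊤ : ℕ∞) ψ → ∀ ε : ℝ,
        cderivTuple n v (tensorScale n g ψ ε) =
          fun p => G p.1 * (ε⁻¹ ^ j * iteratedDeriv j ψ (ε⁻¹ * p.2)) := by
  induction k with
  | zero =>
    exact ⟨g, 0, hg, hgc, le_rfl, fun _ => rfl, fun ψ _ ε => by
      funext p; simp [cderivTuple, tensorScale]⟩
  | succ k ih =>
    obtain ⟨G, j, hG, hGc, hjk, hj, H⟩ := ih (Fin.tail v)
    have hd : ∀ ψ : ℝ → ℝ, ContDiff ℝ (⊤ : ℕ∞) ψ → Differentiable ℝ (iteratedDeriv j ψ) :=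
      fun ψ hψ => hψ.differentiable_iteratedDeriv j (by exact_mod_cast ENat.natCast_lt_top j)
    have hGd : Differentiable ℝ G := hG.differentiable (by simp)
    by_cases hi : ((v 0 : Fin (n + 1)) : ℕ) < n
    · refine ⟨fun x => fderiv ℝ G x (EuclideanSpace.single ⟨v 0, hi⟩ 1), j, ?_,
        hGc.fderiv_apply ℝ _, by lia, by lia, fun ψ hψ ε => ?_⟩
      · exact (hG.fderiv_right (m := (⊤ : ℕ∞)) (by simp)).clm_apply contDiff_const
      · funext p
        simp only [cderivTuple, H ψ hψ ε]
        rw [fderiv_tensor_apply hGd (hd ψ hψ)]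
        simp [dirH, hi]
    · refine ⟨G, j + 1, hG, hGc, by lia, fun h => hj (by lia), fun ψ hψ ε => ?_⟩
      funext p
      simp only [cderivTuple, H ψ hψ ε]
      rw [fderiv_tensor_apply hGd (hd ψ hψ), iteratedDeriv_succ]
      simp only [dirH, hi, dite_false, map_zero]
      ring

lemma contDiff_cderivTuple {n k : ℕ} (v : Fin k → Fin (n + 1)) {u : En n × ℝ → ℝ}
    (hu : ContDiff ℝ (⊤ : ℕ∞) u) : ContDiff ℝ (⊤ : ℕ∞) (cderivTuple n v u) := by
  induction k with
  | zero => exact hu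
  | succ k ih =>
    exact ((ih (Fin.tail v)).fderiv_right (m := (⊤ : ℕ∞)) (by simp)).clm_apply contDiff_const

lemma measurableSet_halfSpace (n : ℕ) : MeasurableSet (halfSpace n) :=
  MeasurableSet.univ.prod measurableSet_Ioi

lemma lintegral_halfSpace_tensor_le {n m j : ℕ} (hj : j ≤ m + 1) {G : En n → ℝ}
    (hG : Continuous G) {h : ℝ → ℝ} {B : ℝ} (hB : ∀ s, |h s| ≤ B) (hsupp : ∀ s, 1 < s → h s = 0)
    {ε : ℝ} (hε : 0 < ε) :
    ∫⁻ p in halfSpace n,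
        ENNReal.ofReal (p.2 ^ (m : ℝ) * |G p.1 * (ε⁻¹ ^ j * h (ε⁻¹ * p.2))|) ≤
      ENNReal.ofReal (ε ^ (m + 1 - j) * B) * ∫⁻ x, ENNReal.ofReal |G x| := by
  have hB0 : 0 ≤ B := (abs_nonneg _).trans (hB 0)
  set K : ℝ := ε ^ m * (ε⁻¹ ^ j * B) with hK
  have hK0 : 0 ≤ K := by positivity
  calc
    _ ≤ ∫⁻ p in halfSpace n, ENNReal.ofReal |G p.1| *
          (Ioc 0 ε).indicator (fun _ => ENNReal.ofReal K) p.2 := by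
      refine setLIntegral_mono' (measurableSet_halfSpace n) fun p hp => ?_
      have hp0 : 0 < p.2 := hp.2
      by_cases hpε : p.2 ≤ ε
      · rw [indicator_of_mem (show p.2 ∈ Ioc 0 ε from ⟨hp0, hpε⟩),
          ← ENNReal.ofReal_mul (abs_nonneg _), Real.rpow_natCast]
        apply ENNReal.ofReal_le_ofReal
        rw [abs_mul, abs_mul, abs_of_nonneg (show 0 ≤ ε⁻¹ ^ j by positivity)]
        have h1 : p.2 ^ m ≤ ε ^ m := pow_le_pow_left₀ hp0.le hpε m
        calc p.2 ^ m * (|G p.1| * (ε⁻¹ ^ j * |h (ε⁻¹ * p.2)|))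
            ≤ ε ^ m * (|G p.1| * (ε⁻¹ ^ j * B)) := by gcongr; exact hB _
          _ = |G p.1| * K := by rw [hK]; ring
      · rw [hsupp]
        · simp
        · rw [inv_mul_eq_div, one_lt_div hε]; exact not_le.1 hpε
    _ ≤ ∫⁻ p : En n × ℝ, ENNReal.ofReal |G p.1| *
          (Ioc 0 ε).indicator (fun _ => ENNReal.ofReal K) p.2 := setLIntegral_le_lintegral _ _
    _ = (∫⁻ x, ENNReal.ofReal |G x|) *
          ∫⁻ t, (Ioc 0 ε).indicator (fun _ => ENNReal.ofReal K) t := by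
      rw [Measure.volume_eq_prod]
      exact lintegral_prod_mul (f := fun x => ENNReal.ofReal |G x|)
        (by fun_prop) (measurable_const.indicator measurableSet_Ioc).aemeasurable
    _ = _ := by
      rw [lintegral_indicator_const measurableSet_Ioc, Real.volume_Ioc, sub_zero,
        ← ENNReal.ofReal_mul hK0, mul_comm]
      congr 2
      have : ε ^ (m + 1) = ε ^ (m + 1 - j) * ε ^ j := by rw [← pow_add]; congr 1; lia
      rw [hK, inv_pow]
      field_simp
      linear_combination B * this

lemma lintegral_abs_ne_top_of_hasCompactSupport {n : ℕ} {G : En n → ℝ} (hG : Continuous G)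
    (hGc : HasCompactSupport G) : ∫⁻ x, ENNReal.ofReal |G x| ≠ ⊤ := by
  have := (hG.integrable_of_hasCompactSupport hGc (μ := volume)).2
  simpa [HasFiniteIntegral, Real.enorm_eq_ofReal_abs] using this.ne

/-- At small scales the weighted norms of the derivatives of `g(x) ψ(t / ε)` are controlled by
`‖g‖_{L¹}`, up to an arbitrarily small error. -/
lemma exists_scale {n m : ℕ} {ψ : ℝ → ℝ} (hψ : ContDiff ℝ (⊤ : ℕ∞) ψ) {B : ℝ} (hB0 : 0 < B)
    (hB : ∀ j ≤ m + 1, ∀ s, |iteratedDeriv j ψ s| ≤ B)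
    (hsupp : ∀ j s, 1 < s → iteratedDeriv j ψ s = 0)
    {g : En n → ℝ} (hg : ContDiff ℝ (⊤ : ℕ∞) g) (hgc : HasCompactSupport g)
    {δ : ℝ≥0∞} (hδ : δ ≠ 0) {η : ℝ} (hη : 0 < η) :
    ∃ ε : ℝ, 0 < ε ∧ ε ≤ η ∧ ∀ k ≤ m + 1, ∀ v : Fin k → Fin (n + 1),
      ∫⁻ p in halfSpace n,
          ENNReal.ofReal (p.2 ^ (m : ℝ) * |cderivTuple n v (tensorScale n g ψ ε) p|) ≤
        ENNReal.ofReal B * ((∫⁻ x, ENNReal.ofReal |g x|) + δ) := by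
  have key : ∀ k : Fin (m + 2), ∀ v : Fin k → Fin (n + 1), ∀ᶠ ε : ℝ in 𝓝[>] 0,
      ∫⁻ p in halfSpace n,
          ENNReal.ofReal (p.2 ^ (m : ℝ) * |cderivTuple n v (tensorScale n g ψ ε) p|) ≤
        ENNReal.ofReal B * ((∫⁻ x, ENNReal.ofReal |g x|) + δ) := by
    intro k v
    obtain ⟨G, j, hG, hGc, hjk, hj, H⟩ := exists_cderivTuple_tensorScale n v hg hgc
    have hkm : (k : ℕ) ≤ m + 1 := Nat.lt_succ_iff.1 k.2
    have hjm : j ≤ m + 1 := hjk.trans hkm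
    have main : ∀ ε : ℝ, 0 < ε → ∫⁻ p in halfSpace n,
          ENNReal.ofReal (p.2 ^ (m : ℝ) * |cderivTuple n v (tensorScale n g ψ ε) p|) ≤
        ENNReal.ofReal (ε ^ (m + 1 - j) * B) * ∫⁻ x, ENNReal.ofReal |G x| := by
      intro ε hε
      rw [H ψ hψ ε]
      exact lintegral_halfSpace_tensor_le hjm hG.continuous (hB j hjm) (hsupp j) hε
    rcases hjm.eq_or_lt with hjm' | hjm'
    · have hGg : G = g := hj (by lia)
      filter_upwards [self_mem_nhdsWithin] with ε hε
      refine (main ε hε).trans ?_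
      rw [hjm', Nat.sub_self, pow_zero, one_mul, hGg]
      gcongr
      exact le_self_add
    · have ht : Tendsto (fun ε : ℝ => ENNReal.ofReal (ε ^ (m + 1 - j) * B) *
          ∫⁻ x, ENNReal.ofReal |G x|) (𝓝[>] 0) (𝓝 0) := by
        have h1 : Tendsto (fun ε : ℝ => ENNReal.ofReal (ε ^ (m + 1 - j) * B)) (𝓝[>] 0) (𝓝 0) := by
          have h2 : Continuous fun ε : ℝ => ENNReal.ofReal (ε ^ (m + 1 - j) * B) :=
            ENNReal.continuous_ofReal.comp (by fun_prop)
          have h3 := (h2.tendsto 0).mono_left (nhdsWithin_le_nhds (s := Ioi 0))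
          rwa [zero_pow (by lia), zero_mul, ENNReal.ofReal_zero] at h3
        simpa using ENNReal.Tendsto.mul_const h1
          (Or.inr (lintegral_abs_ne_top_of_hasCompactSupport hG.continuous hGc))
      have hpos : 0 < ENNReal.ofReal B * ((∫⁻ x, ENNReal.ofReal |g x|) + δ) := by
        refine ENNReal.mul_pos (by simpa using hB0) ?_
        simp [hδ]
      filter_upwards [self_mem_nhdsWithin, ht.eventually_lt_const hpos] with ε hε h
      exact (main ε hε).trans h.le
  have hall : ∀ᶠ ε : ℝ in 𝓝[>] 0, ∀ k : Fin (m + 2), ∀ v : Fin k → Fin (n + 1),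
      ∫⁻ p in halfSpace n,
          ENNReal.ofReal (p.2 ^ (m : ℝ) * |cderivTuple n v (tensorScale n g ψ ε) p|) ≤
        ENNReal.ofReal B * ((∫⁻ x, ENNReal.ofReal |g x|) + δ) :=
    eventually_all.2 fun k => eventually_all.2 (key k)
  obtain ⟨ε, h, hε⟩ := (hall.and (Ioc_mem_nhdsGT hη)).exists
  exact ⟨ε, hε.1, hε.2, fun k hk v => h ⟨k, Nat.lt_succ_iff.2 hk⟩ v⟩

lemma exists_contDiff_lintegral_sub_le {n : ℕ} {f : En n → ℝ} (hf : Integrable f) {c : ℝ≥0∞}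
    (hc : c ≠ 0) : ∃ g : En n → ℝ, ContDiff ℝ (⊤ : ℕ∞) g ∧ HasCompactSupport g ∧
      ∫⁻ x, ENNReal.ofReal |f x - g x| ≤ c := by
  have hc1 : min c 1 ≠ ⊤ := by simp
  have hc0 : min c 1 ≠ 0 := by simp [hc]
  obtain ⟨g, hgc, hg, h⟩ := (memLp_one_iff_integrable.2 hf).exist_eLpNorm_sub_le
    ENNReal.one_ne_top le_rfl (ENNReal.toReal_pos hc0 hc1)
  refine ⟨g, hg, hgc, ?_⟩
  rw [ENNReal.ofReal_toReal hc1, eLpNorm_one_eq_lintegral_enorm] at h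
  simpa [Real.enorm_eq_ofReal_abs] using h.trans (min_le_left _ _)

lemma exists_contDiff_approx_seq {n : ℕ} {f : En n → ℝ} (hf : Integrable f)
    (h0 : ∫⁻ x, ENNReal.ofReal |f x| ≠ 0) :
    ∃ s : ℕ → En n → ℝ, s 0 = 0 ∧ (∀ i, ContDiff ℝ (⊤ : ℕ∞) (s i)) ∧
      (∀ i, HasCompactSupport (s i)) ∧
      ∀ i, ∫⁻ x, ENNReal.ofReal |f x - s i x| ≤ 2⁻¹ ^ i * ∫⁻ x, ENNReal.ofReal |f x| := by
  have H : ∀ i : ℕ, ∃ g : En n → ℝ, ContDiff ℝ (⊤ : ℕ∞) g ∧ HasCompactSupport g ∧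
      ∫⁻ x, ENNReal.ofReal |f x - g x| ≤ 2⁻¹ ^ i * ∫⁻ x, ENNReal.ofReal |f x| := fun i =>
    exists_contDiff_lintegral_sub_le hf (mul_ne_zero (by simp) h0)
  choose g hg hgc hgf using H
  refine ⟨fun i => if i = 0 then 0 else g i, by simp, fun i => ?_, fun i => ?_, fun i => ?_⟩
  · by_cases hi : i = 0
    · simp only [hi, if_true]; exact contDiff_const
    · simp only [hi, if_false]; exact hg i
  · by_cases hi : i = 0
    · simp only [hi, if_true]; exact HasCompactSupport.zero
    · simp only [hi, if_false]; exact hgc i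
  · by_cases hi : i = 0
    · simp [hi]
    · simpa only [hi, if_false] using hgf i

/-- A family of functions on the half space all but finitely many of which vanish on each
`{t ≥ δ}`, `δ > 0`. -/
def VanishesAwayFromBoundary {n : ℕ} (w : ℕ → En n × ℝ → ℝ) : Prop :=
  ∀ δ : ℝ, 0 < δ → ∃ N, ∀ i ≥ N, ∀ p : En n × ℝ, δ ≤ p.2 → w i p = 0

lemma tsum_eq_sum_range_of_vanish {w : ℕ → ℝ} {N : ℕ} (h : ∀ i ≥ N, w i = 0) :
    ∑' i, w i = ∑ i ∈ Finset.range N, w i :=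
  tsum_eq_sum fun i hi => h i (by simpa using hi)

lemma VanishesAwayFromBoundary.continuousOn_tsum {n : ℕ} {w : ℕ → En n × ℝ → ℝ}
    (hw : VanishesAwayFromBoundary w) (hc : ∀ i, Continuous (w i)) :
    ContinuousOn (fun p => ∑' i, w i p) (halfSpace n) := by
  intro p hp
  have hp0 : 0 < p.2 := hp.2
  obtain ⟨N, hN⟩ := hw (p.2 / 2) (by positivity)
  have h1 : ContinuousAt (fun q => ∑ i ∈ Finset.range N, w i q) p :=
    (continuous_finsetSum _ fun i _ => hc i).continuousAt
  refine (h1.congr ?_).continuousWithinAt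
  have : ∀ᶠ q : En n × ℝ in 𝓝 p, p.2 / 2 < q.2 :=
    continuousAt_snd.eventually_const_lt (by linarith : p.2 / 2 < p.2)
  filter_upwards [this] with q hq
  exact (tsum_eq_sum_range_of_vanish fun i hi => hN i hi q hq.le).symm

lemma exists_pos_le_snd_of_isCompact {n : ℕ} {K : Set (En n × ℝ)} (hK : IsCompact K)
    (hKH : K ⊆ halfSpace n) : ∃ δ : ℝ, 0 < δ ∧ ∀ p ∈ K, δ ≤ p.2 := by
  rcases K.eq_empty_or_nonempty with rfl | hne
  · exact ⟨1, one_pos, by simp⟩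
  · obtain ⟨q, hq, hmin⟩ := hK.exists_isMinOn hne continuous_snd.continuousOn
    exact ⟨q.2, (hKH hq).2, fun p hp => hmin hp⟩

lemma integral_mul_fderiv_eq_neg_of_contDiff {n : ℕ} {W φ : En n × ℝ → ℝ}
    (hW : ContDiff ℝ (⊤ : ℕ∞) W) (hφ : ContDiff ℝ (⊤ : ℕ∞) φ) (hφc : HasCompactSupport φ)
    (e : En n × ℝ) : ∫ p, W p * fderiv ℝ φ p e = - ∫ p, fderiv ℝ W p e * φ p := by
  have c1 : Continuous fun p => fderiv ℝ W p e :=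
    ((hW.continuous_fderiv (by simp)).clm_apply continuous_const)
  have c2 : Continuous fun p => fderiv ℝ φ p e :=
    ((hφ.continuous_fderiv (by simp)).clm_apply continuous_const)
  have : (volume : Measure (En n × ℝ)).IsAddHaarMeasure := by
    rw [Measure.volume_eq_prod]; infer_instance
  refine integral_mul_fderiv_eq_neg_fderiv_mul_of_integrable ?_ ?_ ?_
    (fun x _ => hW.differentiable (by simp) x) (fun x _ => hφ.differentiable (by simp) x)
  · exact (c1.mul hφ.continuous).integrable_of_hasCompactSupport hφc.mul_left
  · exact (hW.continuous.mul c2).integrable_of_hasCompactSupport (hφc.fderiv_apply ℝ e).mul_left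
  · exact (hW.continuous.mul hφ.continuous).integrable_of_hasCompactSupport hφc.mul_left

lemma VanishesAwayFromBoundary.isWeakDerivH_tsum {n : ℕ} {w w' : ℕ → En n × ℝ → ℝ}
    {e : En n × ℝ} (hw : VanishesAwayFromBoundary w) (hw' : VanishesAwayFromBoundary w')
    (hs : ∀ i, ContDiff ℝ (⊤ : ℕ∞) (w i)) (hd : ∀ i p, w' i p = fderiv ℝ (w i) p e) :
    IsWeakDerivH n e (fun p => ∑' i, w i p) (fun p => ∑' i, w' i p) := by
  intro φ hφ hφc hφH
  obtain ⟨δ, hδ, hδφ⟩ := exists_pos_le_snd_of_isCompact hφc hφH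
  obtain ⟨N₁, hN₁⟩ := hw δ hδ
  obtain ⟨N₂, hN₂⟩ := hw' δ hδ
  set N := max N₁ N₂
  have e1 : ∀ p, (∑' i, w i p) * fderiv ℝ φ p e =
      (∑ i ∈ Finset.range N, w i p) * fderiv ℝ φ p e := by
    intro p
    by_cases hp : p ∈ tsupport φ
    · rw [tsum_eq_sum_range_of_vanish fun i hi =>
        hN₁ i (le_trans (le_max_left _ N₂) hi) p (hδφ p hp)]
    · have : fderiv ℝ φ p = 0 := by
        by_contra h
        exact hp (support_fderiv_subset ℝ h)
      simp [this]
  have e2 : ∀ p, (∑' i, w' i p) * φ p =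
      fderiv ℝ (fun q => ∑ i ∈ Finset.range N, w i q) p e * φ p := by
    intro p
    by_cases hp : p ∈ tsupport φ
    · rw [tsum_eq_sum_range_of_vanish fun i hi =>
        hN₂ i (le_trans (le_max_right N₁ _) hi) p (hδφ p hp),
        fderiv_fun_sum fun i _ => (hs i).differentiable (by simp) p]
      simp [hd, N]
    · rw [image_eq_zero_of_notMem_tsupport hp]; simp
  simp_rw [e1, e2]
  exact integral_mul_fderiv_eq_neg_of_contDiff (ContDiff.sum fun i _ => hs i) hφ hφc e

lemma exists_cutoff (m : ℕ) : ∃ (ψ : ℝ → ℝ) (B : ℝ), ContDiff ℝ (⊤ : ℕ∞) ψ ∧ 0 < B ∧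
    (∀ j ≤ m + 1, ∀ s, |iteratedDeriv j ψ s| ≤ B) ∧
    (∀ j s, 1 < s → iteratedDeriv j ψ s = 0) ∧
    (∀ s, 0 ≤ ψ s ∧ ψ s ≤ 1) ∧ (∀ s, 0 ≤ s → s ≤ 1 / 2 → ψ s = 1) := by
  let ψ : ContDiffBump (0 : ℝ) := ⟨1 / 2, 1, by norm_num, by norm_num⟩
  have hψ : ContDiff ℝ (⊤ : ℕ∞) ψ := ψ.contDiff
  have hsupp : ∀ j, Function.support (iteratedFDeriv ℝ j ψ) ⊆ Metric.closedBall (0 : ℝ) 1 :=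
    fun j => (support_iteratedFDeriv_subset j).trans ψ.tsupport_eq.subset
  have hb : ∀ j : ℕ, ∃ b : ℝ, ∀ s, |iteratedDeriv j ψ s| ≤ b := by
    intro j
    obtain ⟨b, hb⟩ := (ψ.hasCompactSupport.iteratedFDeriv (𝕜 := ℝ) j).exists_bound_of_continuous
      (hψ.continuous_iteratedFDeriv (by exact_mod_cast le_top))
    refine ⟨b, fun s => ?_⟩
    rw [← Real.norm_eq_abs, ← norm_iteratedFDeriv_eq_norm_iteratedDeriv]
    exact hb s
  choose b hb using hb
  have hb0 : ∀ j, 0 ≤ b j := fun j => (abs_nonneg _).trans (hb j 0)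
  refine ⟨ψ, ∑ j ∈ Finset.range (m + 2), b j + 1, hψ, ?_, fun j hj s => ?_, fun j s hs => ?_,
    fun s => ⟨ψ.nonneg, ψ.le_one⟩, fun s h0 h1 => ?_⟩
  · have := Finset.sum_nonneg fun j (_ : j ∈ Finset.range (m + 2)) => hb0 j
    linarith
  · have := Finset.single_le_sum (fun j _ => hb0 j)
      (Finset.mem_range.2 (Nat.lt_succ_iff.2 hj) : j ∈ Finset.range (m + 2))
    linarith [hb j s]
  · by_contra h
    have h' : iteratedFDeriv ℝ j ψ s ≠ 0 := by
      rwa [← norm_ne_zero_iff, norm_iteratedFDeriv_eq_norm_iteratedDeriv, norm_ne_zero_iff]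
    have := hsupp j h'
    rw [mem_closedBall_zero_iff, Real.norm_eq_abs] at this
    linarith [le_abs_self s]
  · refine ψ.one_of_mem_closedBall ?_
    rw [mem_closedBall_zero_iff, Real.norm_eq_abs, abs_of_nonneg h0]
    exact h1

lemma contDiff_tensorScale {n : ℕ} {g : En n → ℝ} {ψ : ℝ → ℝ} (hg : ContDiff ℝ (⊤ : ℕ∞) g)
    (hψ : ContDiff ℝ (⊤ : ℕ∞) ψ) (ε : ℝ) : ContDiff ℝ (⊤ : ℕ∞) (tensorScale n g ψ ε) :=
  (hg.comp contDiff_fst).mul (hψ.comp (contDiff_const.mul contDiff_snd))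

lemma vanishesAwayFromBoundary_cderivTuple {n k : ℕ} (v : Fin k → Fin (n + 1)) {ψ : ℝ → ℝ}
    (hψ : ContDiff ℝ (⊤ : ℕ∞) ψ) (hsupp : ∀ j s, 1 < s → iteratedDeriv j ψ s = 0)
    {g : ℕ → En n → ℝ} (hg : ∀ i, ContDiff ℝ (⊤ : ℕ∞) (g i)) (hgc : ∀ i, HasCompactSupport (g i))
    {ε : ℕ → ℝ} (hε : ∀ i, 0 < ε i) (hlim : Tendsto ε atTop (𝓝 0)) :
    VanishesAwayFromBoundary fun i => cderivTuple n v (tensorScale n (g i) ψ (ε i)) := by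
  intro δ hδ
  obtain ⟨N, hN⟩ := eventually_atTop.1 (hlim.eventually_lt_const hδ)
  refine ⟨N, fun i hi p hp => ?_⟩
  obtain ⟨G, j, -, -, -, -, H⟩ := exists_cderivTuple_tensorScale n v (hg i) (hgc i)
  have h1 : 1 < (ε i)⁻¹ * p.2 := by
    rw [inv_mul_eq_div, one_lt_div (hε i)]; exact (hN i hi).trans_le hp
  simp [H ψ hψ (ε i), hsupp j _ h1]

lemma lintegral_abs_add_le {n : ℕ} {a b : En n → ℝ} (ha : AEMeasurable a) :
    ∫⁻ x, ENNReal.ofReal |a x + b x| ≤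
      (∫⁻ x, ENNReal.ofReal |a x|) + ∫⁻ x, ENNReal.ofReal |b x| := by
  have ha' : AEMeasurable fun x => ENNReal.ofReal |a x| := by fun_prop
  rw [← lintegral_add_left' ha']
  refine lintegral_mono fun x => ?_
  rw [← ENNReal.ofReal_add (abs_nonneg _) (abs_nonneg _)]
  exact ENNReal.ofReal_le_ofReal (abs_add_le _ _)

/-- The trace of `∑ gᵢ(x) ψ(t / εᵢ)` at `t = 0` is `∑ gᵢ`. -/
lemma traceL1_tsum {n : ℕ} {ψ : ℝ → ℝ} (hψ : ∀ s, 0 ≤ ψ s ∧ ψ s ≤ 1)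
    (hψ1 : ∀ s, 0 ≤ s → s ≤ 1 / 2 → ψ s = 1) {g : ℕ → En n → ℝ} (hg : ∀ i, Continuous (g i))
    {ε : ℕ → ℝ} (hε : ∀ i, 0 < ε i)
    (hvan : VanishesAwayFromBoundary fun i => tensorScale n (g i) ψ (ε i)) {f : En n → ℝ}
    (hsum : ∑' i, ∫⁻ x, ENNReal.ofReal |g i x| ≠ ⊤)
    (hfg : Tendsto (fun N => ∫⁻ x, ENNReal.ofReal |∑ i ∈ Finset.range N, g i x - f x|)
      atTop (𝓝 0)) :
    TraceL1 n (fun p => ∑' i, tensorScale n (g i) ψ (ε i) p) f := by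
  set A : ℕ → ℝ≥0∞ := fun i => ∫⁻ x, ENNReal.ofReal |g i x| with hA
  have key : ∀ N₀ : ℕ, ∀ᶠ t : ℝ in 𝓝[>] 0,
      ∫⁻ x, ENNReal.ofReal |∑' i, tensorScale n (g i) ψ (ε i) (x, t) - f x| ≤
        ∑' i, A (i + N₀) := by
    intro N₀
    have hsmall : ∀ᶠ t : ℝ in 𝓝[>] 0, ∀ i ∈ Finset.range N₀, t ≤ ε i / 2 :=
      (Finset.eventually_all _).2 fun i _ => by
        filter_upwards [Ioc_mem_nhdsGT (half_pos (hε i))] with t ht using ht.2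
    filter_upwards [hsmall, self_mem_nhdsWithin] with t ht ht0
    have ht0 : 0 < t := ht0
    obtain ⟨N₁, hN₁⟩ := hvan t ht0
    have hone : ∀ i < N₀, ψ ((ε i)⁻¹ * t) = 1 := fun i hi => by
      refine hψ1 _ (mul_nonneg (inv_nonneg.2 (hε i).le) ht0.le) ?_
      rw [inv_mul_eq_div, div_le_iff₀ (hε i)]
      linarith [ht i (Finset.mem_range.2 hi)]
    have hle : ∀ M ≥ N₁,
        ∫⁻ x, ENNReal.ofReal |∑' i, tensorScale n (g i) ψ (ε i) (x, t) - f x| ≤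
          ∑' i, A (i + N₀) + ∫⁻ x, ENNReal.ofReal |∑ i ∈ Finset.range M, g i x - f x| := by
      intro M hM
      have hdec : ∀ x, ∑' i, tensorScale n (g i) ψ (ε i) (x, t) - f x =
          (∑ i ∈ Finset.range M, g i x * (ψ ((ε i)⁻¹ * t) - 1)) +
            (∑ i ∈ Finset.range M, g i x - f x) := fun x => by
        rw [tsum_eq_sum_range_of_vanish fun i hi => hN₁ i (hM.trans hi) (x, t) le_rfl]
        simp only [tensorScale, mul_sub, mul_one, Finset.sum_sub_distrib]
        ring
      simp_rw [hdec]
      refine (lintegral_abs_add_le ?_).trans (add_le_add_left ?_ _)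
      · exact (continuous_finsetSum _ fun i _ => (hg i).mul continuous_const).aemeasurable
      calc ∫⁻ x, ENNReal.ofReal |∑ i ∈ Finset.range M, g i x * (ψ ((ε i)⁻¹ * t) - 1)|
          ≤ ∫⁻ x, ∑' i, ENNReal.ofReal |g (i + N₀) x| := by
            refine lintegral_mono fun x => ?_
            calc ENNReal.ofReal |∑ i ∈ Finset.range M, g i x * (ψ ((ε i)⁻¹ * t) - 1)|
                ≤ ∑ i ∈ Finset.range M, ENNReal.ofReal |g i x * (ψ ((ε i)⁻¹ * t) - 1)| := by
                  rw [← ENNReal.ofReal_sum_of_nonneg fun i _ => abs_nonneg _]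
                  exact ENNReal.ofReal_le_ofReal (Finset.abs_sum_le_sum_abs _ _)
              _ ≤ ∑' i, ENNReal.ofReal |g i x * (ψ ((ε i)⁻¹ * t) - 1)| :=
                  ENNReal.sum_le_tsum _
              _ = ∑' i, ENNReal.ofReal
                    |g (i + N₀) x * (ψ ((ε (i + N₀))⁻¹ * t) - 1)| := by
                  rw [← ENNReal.summable.sum_add_tsum_nat_add' (k := N₀)]
                  rw [Finset.sum_eq_zero, zero_add]
                  intro i hi
                  simp [hone i (Finset.mem_range.1 hi)]
              _ ≤ _ := by
                  refine ENNReal.tsum_le_tsum fun i => ENNReal.ofReal_le_ofReal ?_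
                  rw [abs_mul]
                  refine mul_le_of_le_one_right (abs_nonneg _) ?_
                  have := hψ ((ε (i + N₀))⁻¹ * t)
                  rw [abs_le]
                  constructor <;> linarith
        _ = ∑' i, A (i + N₀) := by
            refine lintegral_tsum fun i => ?_
            have := (hg (i + N₀)).measurable
            fun_prop
    refine ge_of_tendsto (x := atTop) (f := fun M => ∑' i, A (i + N₀) +
      ∫⁻ x, ENNReal.ofReal |∑ i ∈ Finset.range M, g i x - f x|) ?_ ?_
    · simpa using tendsto_const_nhds.add hfg
    · filter_upwards [eventually_ge_atTop N₁] with M hM using hle M hM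
  refine ENNReal.tendsto_nhds_zero.2 fun η hη => ?_
  obtain ⟨N₀, hN₀⟩ := ((ENNReal.tendsto_sum_nat_add A hsum).eventually_le_const hη).exists
  filter_upwards [key N₀] with t ht using ht.trans hN₀

/-- The weighted Sobolev norm of a countable sum is at most the sum of the weighted `L¹` norms of
all derivatives of all terms. -/
lemma wSobNorm_tsum_le {n m : ℕ} {a : ℝ}
    {w : (k : ℕ) → (Fin k → Fin (n + 1)) → ℕ → En n × ℝ → ℝ}
    (hw : ∀ k v i, Continuous (w k v i)) :
    wSobNorm n m a (fun k v p => ∑' i, w k v i p) ≤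
      ∑ j ∈ Finset.range (m + 2), ∑ v : Fin j → Fin (n + 1), ∑' i,
        ∫⁻ p in halfSpace n, ENNReal.ofReal (p.2 ^ a * |w j v i p|) := by
  refine Finset.sum_le_sum fun j _ => ?_
  have hmeas : ∀ (v : Fin j → Fin (n + 1)) (i : ℕ),
      Measurable fun p : En n × ℝ => ENNReal.ofReal (p.2 ^ a * |w j v i p|) := fun v i => by
    have := (hw j v i).measurable
    fun_prop
  calc
    _ ≤ ∫⁻ p in halfSpace n, ∑ v : Fin j → Fin (n + 1), ∑' i,
          ENNReal.ofReal (p.2 ^ a * |w j v i p|) := by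
      refine setLIntegral_mono' (measurableSet_halfSpace n) fun p hp => ?_
      have hp0 : 0 ≤ p.2 ^ a := Real.rpow_nonneg (le_of_lt hp.2) a
      have hsq : Real.sqrt (∑ v : Fin j → Fin (n + 1), (∑' i, w j v i p) ^ 2) ≤
          ∑ v : Fin j → Fin (n + 1), |∑' i, w j v i p| := by
        refine Real.sqrt_le_iff.2 ⟨Finset.sum_nonneg fun _ _ => abs_nonneg _, ?_⟩
        simp_rw [← sq_abs (∑' i, w j _ i p)]
        exact Finset.sum_sq_le_sq_sum_of_nonneg fun _ _ => abs_nonneg _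
      calc
        _ ≤ ENNReal.ofReal (∑ v : Fin j → Fin (n + 1), p.2 ^ a * |∑' i, w j v i p|) := by
          rw [← Finset.mul_sum]
          exact ENNReal.ofReal_le_ofReal (mul_le_mul_of_nonneg_left hsq hp0)
        _ = ∑ v : Fin j → Fin (n + 1), ENNReal.ofReal (p.2 ^ a * |∑' i, w j v i p|) :=
          ENNReal.ofReal_sum_of_nonneg fun _ _ => mul_nonneg hp0 (abs_nonneg _)
        _ ≤ _ := by
          refine Finset.sum_le_sum fun v _ => ?_
          simp_rw [ENNReal.ofReal_mul hp0]
          rw [ENNReal.tsum_mul_left]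
          gcongr
          simp_rw [← Real.enorm_eq_ofReal_abs]
          exact enorm_tsum_le_tsum_enorm
    _ = _ := by
      rw [lintegral_finsetSum _ fun v _ => Measurable.tsum (hmeas v)]
      exact Finset.sum_congr rfl fun v _ => lintegral_tsum fun i => (hmeas v i).aemeasurable

/-- Theorem `theorem non-homogeneous`, case `a = m`: for every
`f ∈ L¹(ℝⁿ)` there is `F ∈ W_m^{m+1,1}(ℝ₊^{n+1})` (weak derivative data `DF`) with
trace `f` and `‖F‖_{W_m^{m+1,1}} ≤ C ‖f‖_{L¹}`. -/
theorem extension_L1_weight_m (n m : ℕ) (hn : 0 < n) :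
    ∃ C : ℝ, 0 < C ∧
      ∀ f : En n → ℝ, Integrable f →
        ∃ (F : En n × ℝ → ℝ) (DF : (k : ℕ) → (Fin k → Fin (n + 1)) → En n × ℝ → ℝ),
          WeakDerivsH n m F DF ∧
          (∀ k, k ≤ m + 1 → ∀ v : Fin k → Fin (n + 1),
            LocallyIntegrableOn (DF k v) (halfSpace n)) ∧
          TraceL1 n F f ∧
          wSobNorm n m (m : ℝ) DF ≤ ENNReal.ofReal C *
            ∫⁻ x, ENNReal.ofReal |f x| := by
  obtain ⟨ψ, B, hψ, hB0, hB, hsupp, hψ01, hψ1⟩ := exists_cutoff m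
  set κ : ℝ := ∑ j ∈ Finset.range (m + 2), ∑ _v : Fin j → Fin (n + 1), B * 6 with hκ
  have hκ0 : 0 < κ := Finset.sum_pos
    (fun j _ => Finset.sum_pos (fun _ _ => by positivity) Finset.univ_nonempty) (by simp)
  refine ⟨κ, hκ0, fun f hf => ?_⟩
  set L : ℝ≥0∞ := ∫⁻ x, ENNReal.ofReal |f x| with hL
  by_cases hL0 : L = 0
  · refine ⟨0, fun _ _ => 0, ⟨rfl, fun k _ v φ _ _ _ => by simp⟩, fun k _ v => ?_, ?_, ?_⟩
    · exact (locallyIntegrable_zero).locallyIntegrableOn _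
    · simp [TraceL1, ← hL, hL0]
    · simp [wSobNorm]
  have hLtop : L ≠ ⊤ := by
    simpa [HasFiniteIntegral, Real.enorm_eq_ofReal_abs] using hf.2.ne
  obtain ⟨s, hs0, hs, hsc, hsf⟩ := exists_contDiff_approx_seq hf hL0
  set g : ℕ → En n → ℝ := fun i x => s (i + 1) x - s i x with hgdef
  have hg : ∀ i, ContDiff ℝ (⊤ : ℕ∞) (g i) := fun i => (hs (i + 1)).sub (hs i)
  have hgc : ∀ i, HasCompactSupport (g i) := fun i => (hsc (i + 1)).sub (hsc i)
  have hgL : ∀ i, ∫⁻ x, ENNReal.ofReal |g i x| ≤ 2 * (2⁻¹ ^ i * L) := by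
    intro i
    have hrw : ∀ x, |g i x| = |(f x - s i x) + (s (i + 1) x - f x)| := fun x => by
      congr 1; simp only [hgdef]; ring
    simp_rw [hrw]
    refine (lintegral_abs_add_le (hf.1.aemeasurable.sub (hs i).continuous.aemeasurable)).trans ?_
    simp_rw [abs_sub_comm _ (f _)]
    rw [two_mul]
    refine add_le_add (hsf i) ((hsf (i + 1)).trans ?_)
    gcongr ?_ * L
    exact pow_le_pow_of_le_one (by simp) (by simp) (Nat.le_succ i)
  have hex : ∀ i : ℕ, _ := fun i => exists_scale (m := m) hψ hB0 hB hsupp (hg i) (hgc i)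
    (δ := 2⁻¹ ^ i * L) (mul_ne_zero (by simp) hL0) (η := 1 / ((i : ℝ) + 1)) (by positivity)
  choose ε hε hεle hεB using hex
  have hlim : Tendsto ε atTop (𝓝 0) :=
    squeeze_zero (fun i => (hε i).le) hεle tendsto_one_div_add_atTop_nhds_zero_nat
  have hvan : ∀ {k : ℕ} (v : Fin k → Fin (n + 1)),
      VanishesAwayFromBoundary fun i => cderivTuple n v (tensorScale n (g i) ψ (ε i)) := fun v =>
    vanishesAwayFromBoundary_cderivTuple v hψ hsupp hg hgc hε hlim
  have hsm : ∀ (k : ℕ) (v : Fin k → Fin (n + 1)) (i : ℕ),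
      ContDiff ℝ (⊤ : ℕ∞) (cderivTuple n v (tensorScale n (g i) ψ (ε i))) := fun k v i =>
    contDiff_cderivTuple v (contDiff_tensorScale (hg i) hψ (ε i))
  have hgeom : ∀ c : ℝ≥0∞, ∑' i : ℕ, c * (2⁻¹ ^ i * L) = c * (2 * L) := fun c => by
    rw [ENNReal.tsum_mul_left, ENNReal.tsum_mul_right, ENNReal.tsum_geometric,
      ENNReal.one_sub_inv_two, inv_inv]
  refine ⟨fun p => ∑' i, tensorScale n (g i) ψ (ε i) p,
    fun k v p => ∑' i, cderivTuple n v (tensorScale n (g i) ψ (ε i)) p,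
    ⟨rfl, fun k _ v => ?_⟩, fun k _ v => ?_, ?_, ?_⟩
  · exact (hvan (Fin.tail v)).isWeakDerivH_tsum (hvan v) (hsm k (Fin.tail v)) fun _ _ => rfl
  · exact ((hvan v).continuousOn_tsum fun i => (hsm k v i).continuous).locallyIntegrableOn
      (measurableSet_halfSpace n)
  · refine traceL1_tsum hψ01 hψ1 (fun i => (hg i).continuous) hε (hvan Fin.elim0) ?_ ?_
    · refine ne_top_of_le_ne_top ?_ (ENNReal.tsum_le_tsum hgL)
      rw [hgeom]
      finiteness
    · have hpow : Tendsto (fun N : ℕ => (2⁻¹ : ℝ≥0∞) ^ N * L) atTop (𝓝 0) := by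
        simpa using ENNReal.Tendsto.mul_const
          (ENNReal.tendsto_pow_atTop_nhds_zero_of_lt_one ENNReal.one_half_lt_one)
          (Or.inr hLtop)
      refine tendsto_of_tendsto_of_tendsto_of_le_of_le tendsto_const_nhds hpow
        (fun _ => zero_le) fun N => ?_
      have htel : ∀ x, ∑ i ∈ Finset.range N, g i x = s N x := fun x => by
        simp only [hgdef]
        rw [Finset.sum_range_sub fun i => s i x]
        simp [hs0]
      simp_rw [htel, abs_sub_comm _ (f _)]
      exact hsf N
  · refine (wSobNorm_tsum_le fun k v i => (hsm k v i).continuous).trans ?_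
    rw [hκ, ENNReal.ofReal_sum_of_nonneg fun j _ => Finset.sum_nonneg fun _ _ => by positivity,
      Finset.sum_mul]
    refine Finset.sum_le_sum fun j hj => ?_
    rw [ENNReal.ofReal_sum_of_nonneg fun _ _ => by positivity, Finset.sum_mul]
    refine Finset.sum_le_sum fun v _ => ?_
    have hjm : j ≤ m + 1 := Nat.lt_succ_iff.1 (Finset.mem_range.1 hj)
    calc
      _ ≤ ∑' i : ℕ, ENNReal.ofReal B * 3 * (2⁻¹ ^ i * L) := by
        refine ENNReal.tsum_le_tsum fun i => (hεB i j hjm v).trans ?_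
        rw [mul_assoc]
        gcongr
        calc _ ≤ 2 * (2⁻¹ ^ i * L) + 2⁻¹ ^ i * L := by gcongr; exact hgL i
          _ = _ := by ring
      _ = ENNReal.ofReal (B * 6) * L := by
        rw [hgeom, ENNReal.ofReal_mul hB0.le, ENNReal.ofReal_ofNat]
        ring

end
end

section
/- Let n ∈ ℕ, let α ∈ ℕ₀ⁿ be a multi-index and let b ∈ ℝ satisfy n + |α| − b − 1 > 0. There is a constant C = C(n,α,b) > 0 such that for every x ∈ ℝⁿ with x ≠ 0, ∫_0^∞ t^b |∂^α W_t(x)| dt ≤ C / |x|^{n+|α|−b−1}, where ∂^α denotes the partial derivative in x of order α. -/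
open MeasureTheory Filter Set
open scoped ENNReal NNReal Topology

noncomputable section

/-- The polynomial `P` evaluated at the coordinates of `y`. -/
def polyEval {n : ℕ} (P : MvPolynomial (Fin n) ℝ) (y : En n) : ℝ :=
  MvPolynomial.eval (fun j => y j) P

theorem polyEval_fderiv {n : ℕ} (P : MvPolynomial (Fin n) ℝ) (y : En n) :
    DifferentiableAt ℝ (polyEval P) y ∧ ∀ i,
      fderiv ℝ (polyEval P) y (EuclideanSpace.single i 1) =
        polyEval (MvPolynomial.pderiv i P) y := by
  induction P using MvPolynomial.induction_on with
  | C a =>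
    have h : polyEval (n := n) (MvPolynomial.C a) = fun _ => a := by
      funext z; simp [polyEval]
    rw [h]
    refine ⟨differentiableAt_const _, fun i => ?_⟩
    simp [polyEval]
  | add p q hp hq =>
    have h : polyEval (p + q) = fun z => polyEval p z + polyEval q z := by
      funext z; simp [polyEval]
    rw [h]
    refine ⟨hp.1.add hq.1, fun i => ?_⟩
    rw [fderiv_fun_add hp.1 hq.1]
    simp [hp.2 i, hq.2 i, polyEval]
  | mul_X p j hp =>
    have h : polyEval (p * MvPolynomial.X j) =
        fun z => polyEval p z * EuclideanSpace.proj (𝕜 := ℝ) j z := by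
      funext z; simp [polyEval]
    have hX : DifferentiableAt ℝ (fun z : En n => EuclideanSpace.proj (𝕜 := ℝ) j z) y :=
      (EuclideanSpace.proj (𝕜 := ℝ) j).differentiableAt
    rw [h]
    refine ⟨hp.1.mul hX, fun i => ?_⟩
    rw [fderiv_fun_mul hp.1 hX, ContinuousLinearMap.fderiv]
    by_cases hij : i = j
    · subst hij
      simp [hp.2 i, polyEval, Derivation.leibniz]
    · simp [hp.2 i, polyEval, Derivation.leibniz, MvPolynomial.pderiv_X, Ne.symm hij]

/-- The product of a polynomial and the Gaussian `exp (-‖y‖² / 4)`. -/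
def polyGauss {n : ℕ} (P : MvPolynomial (Fin n) ℝ) (y : En n) : ℝ :=
  polyEval P y * Real.exp (-‖y‖ ^ 2 / 4)

theorem polyGauss_fderiv {n : ℕ} (P : MvPolynomial (Fin n) ℝ) (y : En n) :
    DifferentiableAt ℝ (polyGauss P) y ∧ ∀ i,
      fderiv ℝ (polyGauss P) y (EuclideanSpace.single i 1) =
        polyGauss (MvPolynomial.pderiv i P -
          MvPolynomial.C (1 / 2) * (MvPolynomial.X i * P)) y := by
  obtain ⟨hd, hv⟩ := polyEval_fderiv P y
  have hn : HasFDerivAt (fun z : En n => Real.exp (-(1 / 4) * ‖z‖ ^ 2)) _ y :=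
    (((hasFDerivAt_id y).norm_sq).const_mul (-(1 / 4) : ℝ)).exp
  have h := hd.hasFDerivAt.mul hn
  have he : polyGauss P = fun z => polyEval P z * Real.exp (-(1 / 4) * ‖z‖ ^ 2) := by
    funext z
    simp only [polyGauss]
    congr 2
    ring
  rw [he]
  refine ⟨h.differentiableAt, fun i => ?_⟩
  have hin : inner ℝ y (EuclideanSpace.single i (1 : ℝ)) = y i := by
    simpa using EuclideanSpace.inner_single_right i (1 : ℝ) y
  erw [h.fderiv]
  simp only [polyGauss, polyEval] at hv ⊢
  simp [hv i, hin]
  ring_nf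

theorem pd1_scaled_polyGauss {n : ℕ} (i : Fin n) (c s : ℝ) (P : MvPolynomial (Fin n) ℝ) :
    pd1 n i (fun x => c * polyGauss P (s • x)) =
      fun x => c * s * polyGauss (MvPolynomial.pderiv i P -
          MvPolynomial.C (1 / 2) * (MvPolynomial.X i * P)) (s • x) := by
  funext x
  obtain ⟨hd, hv⟩ := polyGauss_fderiv P (s • x)
  have h : HasFDerivAt (fun x => c * polyGauss P (s • x)) _ x :=
    (hd.hasFDerivAt.comp x ((hasFDerivAt_id x).const_smul s)).const_mul c
  rw [pd1, h.fderiv, ← hv i]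
  simp
  ring

theorem exists_iterate_pd1_polyGauss {n : ℕ} (i : Fin n) (k m : ℕ)
    (P : MvPolynomial (Fin n) ℝ) :
    ∃ Q : MvPolynomial (Fin n) ℝ, ∀ s : ℝ,
      (pd1 n i)^[k] (fun x => s ^ m * polyGauss P (s • x)) =
        fun x => s ^ (k + m) * polyGauss Q (s • x) := by
  induction k with
  | zero => exact ⟨P, fun s => by simp⟩
  | succ k ih =>
    obtain ⟨Q, hQ⟩ := ih
    refine ⟨MvPolynomial.pderiv i Q - MvPolynomial.C (1 / 2) * (MvPolynomial.X i * Q),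
      fun s => ?_⟩
    rw [Function.iterate_succ_apply', hQ, pd1_scaled_polyGauss, ← pow_succ, add_right_comm]

theorem exists_pdMulti_gaussWt (n : ℕ) (α : Fin n → ℕ) :
    ∃ Q : MvPolynomial (Fin n) ℝ, ∀ (t : ℝ) (x : En n),
      pdMulti n α (gaussWt n t) x =
        t⁻¹ ^ ((∑ i, α i) + n) * polyGauss Q (t⁻¹ • x) := by
  have key : ∀ l : List (Fin n), ∃ Q : MvPolynomial (Fin n) ℝ, ∀ t : ℝ,
      l.foldr (fun i h => (pd1 n i)^[α i] h) (gaussWt n t) =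
        fun x => t⁻¹ ^ ((l.map α).sum + n) * polyGauss Q (t⁻¹ • x) := by
    intro l
    induction l with
    | nil =>
      refine ⟨MvPolynomial.C ((4 * Real.pi) ^ ((n : ℝ) / 2))⁻¹, fun t => ?_⟩
      funext x
      simp only [List.foldr_nil, List.map_nil, List.sum_nil, zero_add, gaussWt, gaussW,
        polyGauss, polyEval, MvPolynomial.eval_C, inv_pow]
      ring
    | cons i l ih =>
      obtain ⟨Q, hQ⟩ := ih
      obtain ⟨R, hR⟩ := exists_iterate_pd1_polyGauss i (α i) ((l.map α).sum + n) Q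
      refine ⟨R, fun t => ?_⟩
      rw [List.foldr_cons, hQ, hR, List.map_cons, List.sum_cons, add_assoc]
  obtain ⟨Q, hQ⟩ := key (List.finRange n)
  refine ⟨Q, fun t x => ?_⟩
  rw [pdMulti, hQ, Fin.sum_univ_def]

theorem exists_abs_polyEval_le {n : ℕ} (P : MvPolynomial (Fin n) ℝ) :
    ∃ (A : ℝ) (k : ℕ), 0 ≤ A ∧ ∀ y : En n, |polyEval P y| ≤ A * (1 + ‖y‖) ^ k := by
  induction P using MvPolynomial.induction_on with
  | C a => exact ⟨|a|, 0, abs_nonneg a, fun y => by simp [polyEval]⟩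
  | add p q hp hq =>
    obtain ⟨A, k, hA, hp⟩ := hp
    obtain ⟨B, l, hB, hq⟩ := hq
    refine ⟨A + B, k + l, by positivity, fun y => ?_⟩
    have h1 : (1 : ℝ) ≤ 1 + ‖y‖ := by linarith [norm_nonneg y]
    have hk : (1 + ‖y‖) ^ k ≤ (1 + ‖y‖) ^ (k + l) := pow_le_pow_right₀ h1 (by omega)
    have hl : (1 + ‖y‖) ^ l ≤ (1 + ‖y‖) ^ (k + l) := pow_le_pow_right₀ h1 (by omega)
    calc |polyEval (p + q) y| = |polyEval p y + polyEval q y| := by simp [polyEval]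
      _ ≤ |polyEval p y| + |polyEval q y| := abs_add_le _ _
      _ ≤ A * (1 + ‖y‖) ^ k + B * (1 + ‖y‖) ^ l := add_le_add (hp y) (hq y)
      _ ≤ A * (1 + ‖y‖) ^ (k + l) + B * (1 + ‖y‖) ^ (k + l) := by gcongr
      _ = (A + B) * (1 + ‖y‖) ^ (k + l) := by ring
  | mul_X p j hp =>
    obtain ⟨A, k, hA, hp⟩ := hp
    refine ⟨A, k + 1, hA, fun y => ?_⟩
    have hj : |y j| ≤ 1 + ‖y‖ := by
      have := PiLp.norm_apply_le y j
      rw [Real.norm_eq_abs] at this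
      linarith
    calc |polyEval (p * MvPolynomial.X j) y| = |polyEval p y| * |y j| := by
          simp [polyEval, abs_mul]
      _ ≤ A * (1 + ‖y‖) ^ k * (1 + ‖y‖) := by gcongr; exact hp y
      _ = A * (1 + ‖y‖) ^ (k + 1) := by ring

theorem one_add_pow_mul_exp_neg_sq_le (r : ℝ) (hr : 0 ≤ r) (k : ℕ) :
    (1 + r) ^ k * Real.exp (-r ^ 2 / 4) ≤ k.factorial * Real.exp 2 := by
  have h := Real.pow_div_factorial_le_exp (1 + r) (by positivity) k
  rw [div_le_iff₀ (by positivity)] at h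
  calc (1 + r) ^ k * Real.exp (-r ^ 2 / 4)
      ≤ Real.exp (1 + r) * k.factorial * Real.exp (-r ^ 2 / 4) := by gcongr
    _ = k.factorial * Real.exp (1 + r + -r ^ 2 / 4) := by rw [Real.exp_add (1 + r)]; ring
    _ ≤ k.factorial * Real.exp 2 := by
      gcongr
      nlinarith [sq_nonneg (r - 2)]

theorem exists_abs_polyGauss_le {n : ℕ} (P : MvPolynomial (Fin n) ℝ) (e : ℝ) :
    ∃ M : ℝ, 0 < M ∧ ∀ y : En n, |polyGauss P y| * (1 + ‖y‖) ^ e ≤ M := by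
  obtain ⟨A, k, hA, h⟩ := exists_abs_polyEval_le P
  obtain ⟨N, hN⟩ := exists_nat_ge e
  refine ⟨A * ((k + N).factorial * Real.exp 2) + 1, by positivity, fun y => ?_⟩
  have h1 : (1 : ℝ) ≤ 1 + ‖y‖ := by linarith [norm_nonneg y]
  have he : (1 + ‖y‖) ^ e ≤ (1 + ‖y‖) ^ N := by
    rw [← Real.rpow_natCast]
    exact Real.rpow_le_rpow_of_exponent_le h1 hN
  calc |polyGauss P y| * (1 + ‖y‖) ^ e
      = |polyEval P y| * Real.exp (-‖y‖ ^ 2 / 4) * (1 + ‖y‖) ^ e := by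
        rw [polyGauss, abs_mul, Real.abs_exp]
    _ ≤ A * (1 + ‖y‖) ^ k * Real.exp (-‖y‖ ^ 2 / 4) * (1 + ‖y‖) ^ N := by
        gcongr; exact h y
    _ = A * ((1 + ‖y‖) ^ (k + N) * Real.exp (-‖y‖ ^ 2 / 4)) := by ring
    _ ≤ A * ((k + N).factorial * Real.exp 2) := by
        exact mul_le_mul_of_nonneg_left
          (one_add_pow_mul_exp_neg_sq_le _ (norm_nonneg y) _) hA
    _ ≤ _ := by linarith

theorem lintegral_Ioi_le_of_le_rpow {f : ℝ → ℝ} {M e r : ℝ} (hM : 0 ≤ M) (he : 1 < e)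
    (hr : 0 < r) (hfr : ∀ t, 0 < t → f t ≤ M * r ^ (-e))
    (hft : ∀ t, 0 < t → f t ≤ M * t ^ (-e)) :
    ∫⁻ t in Ioi (0 : ℝ), ENNReal.ofReal (f t) ≤
      ENNReal.ofReal (M * (1 + 1 / (e - 1)) / r ^ (e - 1)) := by
  have hr1 : r ^ (-e) * r = (r ^ (e - 1))⁻¹ := by
    rw [← Real.rpow_add_one hr.ne', ← Real.rpow_neg hr.le]
    congr 1
    ring
  have hnear : ∫⁻ t in Ioc 0 r, ENNReal.ofReal (f t) ≤ ENNReal.ofReal (M * (r ^ (e - 1))⁻¹) := by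
    calc ∫⁻ t in Ioc 0 r, ENNReal.ofReal (f t)
        ≤ ∫⁻ _ in Ioc 0 r, ENNReal.ofReal (M * r ^ (-e)) :=
          setLIntegral_mono' measurableSet_Ioc fun t ht =>
            ENNReal.ofReal_le_ofReal (hfr t ht.1)
      _ = ENNReal.ofReal (M * (r ^ (e - 1))⁻¹) := by
          rw [setLIntegral_const, Real.volume_Ioc, ← ENNReal.ofReal_mul (by positivity), ← hr1]
          congr 1
          ring
  have hfar : ∫⁻ t in Ioi r, ENNReal.ofReal (f t) ≤
      ENNReal.ofReal (M * ((r ^ (e - 1))⁻¹ / (e - 1))) := by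
    calc ∫⁻ t in Ioi r, ENNReal.ofReal (f t)
        ≤ ∫⁻ t in Ioi r, ENNReal.ofReal (M * t ^ (-e)) :=
          setLIntegral_mono' measurableSet_Ioi fun t ht =>
            ENNReal.ofReal_le_ofReal (hft t (hr.trans ht))
      _ = ENNReal.ofReal (∫ t in Ioi r, M * t ^ (-e)) := by
          refine (ofReal_integral_eq_lintegral_ofReal
            ((integrableOn_Ioi_rpow_of_lt (by linarith) hr).const_mul M) ?_).symm
          filter_upwards [ae_restrict_mem measurableSet_Ioi] with t ht
          have : 0 < t := hr.trans ht
          positivity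
      _ = ENNReal.ofReal (M * ((r ^ (e - 1))⁻¹ / (e - 1))) := by
          rw [integral_const_mul, integral_Ioi_rpow_of_lt (by linarith) hr, ← hr1,
            ← Real.rpow_add_one hr.ne', neg_div, ← div_neg]
          congr 4
          ring
  have he' : 0 < e - 1 := by linarith
  rw [← Ioc_union_Ioi_eq_Ioi hr.le]
  refine (lintegral_union_le _ _ _).trans ((add_le_add hnear hfar).trans ?_)
  rw [← ENNReal.ofReal_add (by positivity) (by positivity)]
  apply ENNReal.ofReal_le_ofReal
  apply le_of_eq
  ring

/-- Lemma `lemma heat integral`, first estimate: if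
`n + |α| - b - 1 > 0`, then for every `x ≠ 0`,
`∫_0^∞ t^b |∂^α W_t(x)| dt ≤ C / |x|^{n+|α|-b-1}`. -/
theorem heat_kernel_time_integral (n : ℕ) (hn : 0 < n) (α : Fin n → ℕ) (b : ℝ)
    (hb : 0 < (n : ℝ) + (∑ i, α i : ℕ) - b - 1) :
    ∃ C : ℝ, 0 < C ∧
      ∀ x : En n, x ≠ 0 →
        (∫⁻ t in Set.Ioi (0 : ℝ),
            ENNReal.ofReal (t ^ b * |pdMulti n α (gaussWt n t) x|)) ≤
          ENNReal.ofReal (C / ‖x‖ ^ ((n : ℝ) + (∑ i, α i : ℕ) - b - 1)) := by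
  obtain ⟨Q, hQ⟩ := exists_pdMulti_gaussWt n α
  set m : ℕ := ∑ i, α i with hm
  set e : ℝ := (n : ℝ) + m - b with he
  obtain ⟨M, hM, hbound⟩ := exists_abs_polyGauss_le Q e
  have he1 : 0 < e - 1 := hb
  refine ⟨M * (1 + 1 / (e - 1)), by positivity, fun x hx => ?_⟩
  have hr : 0 < ‖x‖ := norm_pos_iff.mpr hx
  have hform : ∀ t : ℝ, 0 < t → t ^ b * |pdMulti n α (gaussWt n t) x| =
      t ^ (-e) * |polyGauss Q (t⁻¹ • x)| := by
    intro t ht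
    have hpow : |t⁻¹ ^ (m + n)| = t ^ (-((m + n : ℕ) : ℝ)) := by
      rw [abs_of_pos (by positivity), Real.rpow_neg ht.le, Real.rpow_natCast, inv_pow]
    rw [hQ, abs_mul, hpow, ← mul_assoc, ← Real.rpow_add ht]
    congr 2
    rw [he]
    push_cast
    ring
  refine lintegral_Ioi_le_of_le_rpow hM.le (by linarith) hr (fun t ht => ?_) (fun t ht => ?_)
  · rw [hform t ht]
    have hnorm : ‖t⁻¹ • x‖ = t⁻¹ * ‖x‖ := by
      rw [norm_smul, Real.norm_of_nonneg (by positivity)]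
    have h : |polyGauss Q (t⁻¹ • x)| * (t⁻¹ * ‖x‖) ^ e ≤ M := by
      refine le_trans ?_ (hbound (t⁻¹ • x))
      rw [hnorm]
      gcongr
      · linarith
      · linarith
    rw [Real.mul_rpow (by positivity) hr.le, Real.inv_rpow ht.le, ← Real.rpow_neg ht.le] at h
    rw [Real.rpow_neg hr.le, ← div_eq_mul_inv, le_div_iff₀ (by positivity)]
    linarith
  · rw [hform t ht, mul_comm]
    gcongr
    refine le_trans (le_mul_of_one_le_right (abs_nonneg _) ?_) (hbound (t⁻¹ • x))
    exact Real.one_le_rpow (by linarith [norm_nonneg (t⁻¹ • x)]) (by linarith)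

end
end

section
/- Let n ∈ ℕ, m ∈ ℕ and k ∈ ℕ₀ with k < m. There is a constant C = C(n,m,k) > 0 such that for every g ∈ L¹(ℝⁿ) there exists G ∈ W^{m+1,1}_loc(ℝ₊^{n+1}) with ∫_{ℝ₊^{n+1}} t^k |∇^{m+1} G(x,t)| dx dt ≤ C ‖g‖_{L¹(ℝⁿ)}, such that ∂_t^j G(·,t) → 0 in L¹(ℝⁿ) as t → 0⁺ for every j = 0,…,m−k−1, and ∂_t^{m−k} G(·,t) → g in L¹(ℝⁿ) as t → 0⁺. -/
open MeasureTheory Filter Set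
open scoped ENNReal NNReal Topology

noncomputable section

lemma isWeakDerivH_of_eqOn_contDiff {n : ℕ} {e : En n × ℝ} {u v : En n × ℝ → ℝ}
    (h : ∀ δ : ℝ, 0 < δ → ∃ U : En n × ℝ → ℝ, ContDiff ℝ 1 U ∧
      ∀ p : En n × ℝ, δ ≤ p.2 → u p = U p ∧ v p = fderiv ℝ U p e) :
    IsWeakDerivH n e u v := by
  intro φ hφ hφc hφs
  obtain ⟨δ, hδ, hδφ⟩ := IsCompact.exists_forall_le' (f := fun p : En n × ℝ => p.2) (a := 0)
    hφc.isCompact continuous_snd.continuousOn (fun p hp => (hφs hp).2)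
  obtain ⟨U, hU, hUe⟩ := h δ hδ
  have hdφ : Continuous fun p => fderiv ℝ φ p e :=
    (hφ.continuous_fderiv (by simp)).clm_apply continuous_const
  have hdU : Continuous fun p => fderiv ℝ U p e :=
    (hU.continuous_fderiv (by simp)).clm_apply continuous_const
  have hdφc : HasCompactSupport fun p => fderiv ℝ φ p e := hφc.fderiv_apply (𝕜 := ℝ) e
  have e1 : ∀ p, u p * fderiv ℝ φ p e = U p * fderiv ℝ φ p e := by
    intro p
    by_cases hp : p ∈ tsupport φ
    · rw [(hUe p (hδφ p hp)).1]
    · rw [fderiv_of_notMem_tsupport ℝ hp]; simp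
  have e2 : ∀ p, v p * φ p = fderiv ℝ U p e * φ p := by
    intro p
    by_cases hp : p ∈ tsupport φ
    · rw [(hUe p (hδφ p hp)).2]
    · rw [image_eq_zero_of_notMem_tsupport hp]; simp
  simp_rw [e1, e2]
  have : (volume : Measure (En n × ℝ)).IsAddHaarMeasure :=
    inferInstanceAs ((volume : Measure (En n)).prod (volume : Measure ℝ)).IsAddHaarMeasure
  refine integral_mul_fderiv_eq_neg_fderiv_mul_of_integrable ?_ ?_ ?_ ?_ ?_
  · exact (hdU.mul hφ.continuous).integrable_of_hasCompactSupport hφc.mul_left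
  · exact (hU.continuous.mul hdφ).integrable_of_hasCompactSupport hdφc.mul_left
  · exact (hU.continuous.mul hφ.continuous).integrable_of_hasCompactSupport hφc.mul_left
  · exact fun p _ => hU.differentiable (by simp) p
  · exact fun p _ => hφ.differentiable (by simp) p

/-- A smooth compactly supported function of one variable that equals `s ^ r / r!` near `0`. -/
lemma exists_profile (r : ℕ) : ∃ ψ : ℝ → ℝ, ContDiff ℝ (⊤ : ℕ∞) ψ ∧
    (∀ j s, 2 < s → iteratedDeriv j ψ s = 0) ∧
    (∀ j, j ≤ r → iteratedDeriv j ψ 0 = if j = r then 1 else 0) ∧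
    (∀ j, ∃ M, ∀ s, |iteratedDeriv j ψ s| ≤ M) := by
  let b : ContDiffBump (0 : ℝ) := ⟨1, 2, one_pos, one_lt_two⟩
  let ψ : ℝ → ℝ := fun s => (r.factorial : ℝ)⁻¹ * s ^ r * b s
  have hψ : ContDiff ℝ (⊤ : ℕ∞) ψ := (contDiff_const.mul (contDiff_id.pow r)).mul b.contDiff
  have hcs : HasCompactSupport ψ := b.hasCompactSupport.mul_left
  have hsub : tsupport ψ ⊆ Metric.closedBall 0 2 :=
    (tsupport_mul_subset_right).trans b.tsupport_eq.subset
  have hts (j : ℕ) : tsupport (iteratedDeriv j ψ) ⊆ tsupport ψ := by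
    induction j with
    | zero => simp
    | succ j ih =>
      rw [iteratedDeriv_succ]
      exact tsupport_deriv_subset.trans ih
  refine ⟨ψ, hψ, fun j s hs => ?_, fun j hj => ?_, fun j => ?_⟩
  · refine image_eq_zero_of_notMem_tsupport fun h => ?_
    have := hsub (hts j h)
    rw [Metric.mem_closedBall, Real.dist_eq, sub_zero] at this
    linarith [le_abs_self s]
  · have hE : ψ =ᶠ[𝓝 0] fun s => (r.factorial : ℝ)⁻¹ * s ^ r := by
      filter_upwards [b.eventuallyEq_one] with s hs
      simp [ψ, hs]
    rw [hE.iteratedDeriv_eq, iteratedDeriv_const_mul_field, iteratedDeriv_fun_pow_zero]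
    split_ifs
    · exact inv_mul_cancel₀ (by positivity)
    · simp
  · have hc : Continuous (iteratedDeriv j ψ) := hψ.continuous_iteratedDeriv j (by exact_mod_cast le_top)
    have hk : HasCompactSupport (iteratedDeriv j ψ) :=
      hcs.of_isClosed_subset isClosed_closure (hts j)
    exact hk.exists_bound_of_continuous hc

/-- The number of entries of a tuple of directions that point in the normal direction. -/
def vertCount (n : ℕ) : {k : ℕ} → (Fin k → Fin (n + 1)) → ℕ
  | 0, _ => 0
  | _ + 1, v => vertCount n (Fin.tail v) + if v 0 = Fin.last n then 1 else 0

/-- Iterated derivative of a function on `ℝⁿ` along the tangential entries of a tuple of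
directions. -/
def horizDeriv (n : ℕ) : {k : ℕ} → (Fin k → Fin (n + 1)) → (En n → ℝ) → En n → ℝ
  | 0, _, f => f
  | _ + 1, v, f =>
    if v 0 = Fin.last n then horizDeriv n (Fin.tail v) f
    else fun x => fderiv ℝ (horizDeriv n (Fin.tail v) f) x (dirH n (v 0)).1

lemma dirH_last (n : ℕ) : dirH n (Fin.last n) = (0, 1) := by simp [dirH]

lemma dirH_snd_of_ne_last {n : ℕ} {i : Fin (n + 1)} (hi : i ≠ Fin.last n) :
    (dirH n i).2 = 0 := by
  have : (i : ℕ) < n := Fin.val_lt_last hi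
  simp [dirH, this]

lemma vertCount_le {n : ℕ} : ∀ {k : ℕ} (v : Fin k → Fin (n + 1)), vertCount n v ≤ k
  | 0, _ => le_rfl
  | _ + 1, v => by
    have := vertCount_le (Fin.tail v)
    simp only [vertCount]
    split_ifs <;> omega

lemma vertCount_const_last (n : ℕ) : ∀ k : ℕ, vertCount n (fun _ : Fin k => Fin.last n) = k
  | 0 => rfl
  | k + 1 => by
    have : Fin.tail (fun _ : Fin (k + 1) => Fin.last n) = fun _ => Fin.last n := rfl
    simp [vertCount, this, vertCount_const_last n k]

lemma horizDeriv_of_vertCount_eq {n : ℕ} (f : En n → ℝ) :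
    ∀ {k : ℕ} (v : Fin k → Fin (n + 1)), vertCount n v = k → horizDeriv n v f = f
  | 0, _, _ => rfl
  | _ + 1, v, hv => by
    have := vertCount_le (Fin.tail v)
    simp only [vertCount] at hv
    split_ifs at hv with h0
    · simpa [horizDeriv, h0] using horizDeriv_of_vertCount_eq f (Fin.tail v) (by omega)
    · omega

lemma contDiff_horizDeriv {n : ℕ} {f : En n → ℝ} (hf : ContDiff ℝ (⊤ : ℕ∞) f) :
    ∀ {k : ℕ} (v : Fin k → Fin (n + 1)), ContDiff ℝ (⊤ : ℕ∞) (horizDeriv n v f)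
  | 0, _ => hf
  | _ + 1, v => by
    have ih := contDiff_horizDeriv hf (Fin.tail v)
    simp only [horizDeriv]
    split_ifs
    · exact ih
    · exact (ih.fderiv_right (by simp)).clm_apply contDiff_const

lemma hasCompactSupport_horizDeriv {n : ℕ} {f : En n → ℝ} (hf : HasCompactSupport f) :
    ∀ {k : ℕ} (v : Fin k → Fin (n + 1)), HasCompactSupport (horizDeriv n v f)
  | 0, _ => hf
  | _ + 1, v => by
    have ih := hasCompactSupport_horizDeriv hf (Fin.tail v)
    simp only [horizDeriv]
    split_ifs
    · exact ih
    · exact ih.fderiv_apply (𝕜 := ℝ) _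

lemma horizDeriv_zero (n : ℕ) :
    ∀ {k : ℕ} (v : Fin k → Fin (n + 1)), horizDeriv n v (0 : En n → ℝ) = 0
  | 0, _ => rfl
  | _ + 1, v => by
    have ih := horizDeriv_zero n (Fin.tail v)
    simp only [horizDeriv, ih]
    split_ifs
    · rfl
    · ext x; simp

/-- The `j`-th derivative of the rescaled profile `t ↦ ε ^ r * ψ (ε⁻¹ * t)`. -/
def profileDeriv (ψ : ℝ → ℝ) (r : ℕ) (ε : ℝ) (j : ℕ) (t : ℝ) : ℝ :=
  ε ^ r * ε⁻¹ ^ j * iteratedDeriv j ψ (ε⁻¹ * t)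

lemma contDiff_profileDeriv {ψ : ℝ → ℝ} (hψ : ContDiff ℝ (⊤ : ℕ∞) ψ) (r : ℕ) (ε : ℝ) (j : ℕ) :
    ContDiff ℝ (⊤ : ℕ∞) (profileDeriv ψ r ε j) := by
  have h : ContDiff ℝ (⊤ : ℕ∞) (iteratedDeriv j ψ) := by
    rw [iteratedDeriv_eq_iterate]
    exact hψ.iterate_deriv j
  exact contDiff_const.mul (h.comp (contDiff_const.mul contDiff_id))

lemma hasDerivAt_profileDeriv {ψ : ℝ → ℝ} (hψ : ContDiff ℝ (⊤ : ℕ∞) ψ) (r : ℕ) (ε : ℝ) (j : ℕ)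
    (t : ℝ) : HasDerivAt (profileDeriv ψ r ε j) (profileDeriv ψ r ε (j + 1) t) t := by
  have h1 : HasDerivAt (iteratedDeriv j ψ) (iteratedDeriv (j + 1) ψ (ε⁻¹ * t)) (ε⁻¹ * t) := by
    rw [iteratedDeriv_succ]
    exact (hψ.differentiable_iteratedDeriv j (by exact_mod_cast ENat.natCast_lt_top j) _).hasDerivAt
  have h2 : HasDerivAt (fun t => ε⁻¹ * t) ε⁻¹ t := by
    simpa using (hasDerivAt_id t).const_mul ε⁻¹
  refine ((h1.comp t h2).const_mul (ε ^ r * ε⁻¹ ^ j)).congr_deriv ?_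
  rw [profileDeriv]
  ring

lemma profileDeriv_eq_zero {ψ : ℝ → ℝ} (hψ : ∀ j s, 2 < s → iteratedDeriv j ψ s = 0) (r : ℕ)
    {ε : ℝ} (hε : 0 < ε) (j : ℕ) {t : ℝ} (ht : 2 * ε < t) : profileDeriv ψ r ε j t = 0 := by
  rw [profileDeriv, hψ, mul_zero]
  rwa [inv_mul_eq_div, lt_div_iff₀ hε]

/-- The derivative, along the tuple of directions `v`, of the product of `f` with the rescaled
profile. -/
def liftTerm (n : ℕ) (ψ : ℝ → ℝ) (r : ℕ) (ε : ℝ) (f : En n → ℝ) {k : ℕ}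
    (v : Fin k → Fin (n + 1)) (p : En n × ℝ) : ℝ :=
  horizDeriv n v f p.1 * profileDeriv ψ r ε (vertCount n v) p.2

lemma contDiff_liftTerm {n : ℕ} {ψ : ℝ → ℝ} (hψ : ContDiff ℝ (⊤ : ℕ∞) ψ) (r : ℕ) (ε : ℝ)
    {f : En n → ℝ} (hf : ContDiff ℝ (⊤ : ℕ∞) f) {k : ℕ} (v : Fin k → Fin (n + 1)) :
    ContDiff ℝ (⊤ : ℕ∞) (liftTerm n ψ r ε f v) :=
  ((contDiff_horizDeriv hf v).comp contDiff_fst).mul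
    ((contDiff_profileDeriv hψ r ε _).comp contDiff_snd)

lemma fderiv_liftTerm {n : ℕ} {ψ : ℝ → ℝ} (hψ : ContDiff ℝ (⊤ : ℕ∞) ψ) (r : ℕ) (ε : ℝ)
    {f : En n → ℝ} (hf : ContDiff ℝ (⊤ : ℕ∞) f) {k : ℕ} (v : Fin (k + 1) → Fin (n + 1))
    (p : En n × ℝ) :
    fderiv ℝ (liftTerm n ψ r ε f (Fin.tail v)) p (dirH n (v 0)) = liftTerm n ψ r ε f v p := by
  have h1 : HasFDerivAt (fun p : En n × ℝ => horizDeriv n (Fin.tail v) f p.1) _ p :=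
    (((contDiff_horizDeriv hf (Fin.tail v)).differentiable (by simp)) p.1).hasFDerivAt.comp p
      hasFDerivAt_fst
  have h2 : HasFDerivAt
      (fun p : En n × ℝ => profileDeriv ψ r ε (vertCount n (Fin.tail v)) p.2) _ p :=
    (hasDerivAt_profileDeriv hψ r ε (vertCount n (Fin.tail v)) p.2).hasFDerivAt.comp p
      hasFDerivAt_snd
  rw [HasFDerivAt.fderiv (f := liftTerm n ψ r ε f (Fin.tail v)) (h1.mul h2)]
  by_cases h0 : v 0 = Fin.last n
  · simp [liftTerm, horizDeriv, vertCount, h0, dirH_last]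
  · simp [liftTerm, horizDeriv, vertCount, h0, dirH_snd_of_ne_last h0, mul_comm]

lemma exists_forall_profileDeriv_eq_zero {ψ : ℝ → ℝ}
    (hψ : ∀ j s, 2 < s → iteratedDeriv j ψ s = 0) (r : ℕ) {ε : ℕ → ℝ}
    (hε : ∀ i, 0 < ε i) (hε' : ∀ i : ℕ, ε i ≤ 1 / ((i : ℝ) + 1)) {δ : ℝ} (hδ : 0 < δ) :
    ∃ N : ℕ, ∀ i, N ≤ i → ∀ j t, δ ≤ t → profileDeriv ψ r (ε i) j t = 0 := by
  obtain ⟨N, hN⟩ := exists_nat_one_div_lt (half_pos hδ)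
  refine ⟨N, fun i hi j t ht => profileDeriv_eq_zero hψ r (hε i) j ?_⟩
  have : 1 / ((i : ℝ) + 1) ≤ 1 / ((N : ℝ) + 1) := by gcongr
  linarith [hε' i]

/-- The sum of the terms `liftTerm`, derived along the tuple of directions `v`. -/
def liftSum (n : ℕ) (ψ : ℝ → ℝ) (r : ℕ) (ε : ℕ → ℝ) (f : ℕ → En n → ℝ) (k : ℕ)
    (v : Fin k → Fin (n + 1)) (p : En n × ℝ) : ℝ :=
  ∑' i, liftTerm n ψ r (ε i) (f i) v p

lemma exists_liftSum_eq_sum {n : ℕ} {ψ : ℝ → ℝ}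
    (hψ : ∀ j s, 2 < s → iteratedDeriv j ψ s = 0) (r : ℕ) {ε : ℕ → ℝ}
    (hε : ∀ i, 0 < ε i) (hε' : ∀ i : ℕ, ε i ≤ 1 / ((i : ℝ) + 1)) (f : ℕ → En n → ℝ)
    {δ : ℝ} (hδ : 0 < δ) :
    ∃ N : ℕ, ∀ (k : ℕ) (v : Fin k → Fin (n + 1)) (p : En n × ℝ), δ ≤ p.2 →
      liftSum n ψ r ε f k v p = ∑ i ∈ Finset.range N, liftTerm n ψ r (ε i) (f i) v p := by
  obtain ⟨N, hN⟩ := exists_forall_profileDeriv_eq_zero hψ r hε hε' hδ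
  refine ⟨N, fun k v p hp => tsum_eq_sum fun i hi => ?_⟩
  rw [liftTerm, hN i (by simpa using hi) _ _ hp, mul_zero]

lemma isWeakDerivH_liftSum {n : ℕ} {ψ : ℝ → ℝ} (hψs : ContDiff ℝ (⊤ : ℕ∞) ψ)
    (hψ : ∀ j s, 2 < s → iteratedDeriv j ψ s = 0) (r : ℕ) {ε : ℕ → ℝ}
    (hε : ∀ i, 0 < ε i) (hε' : ∀ i : ℕ, ε i ≤ 1 / ((i : ℝ) + 1)) {f : ℕ → En n → ℝ}
    (hf : ∀ i, ContDiff ℝ (⊤ : ℕ∞) (f i)) {k : ℕ} (v : Fin (k + 1) → Fin (n + 1)) :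
    IsWeakDerivH n (dirH n (v 0)) (liftSum n ψ r ε f k (Fin.tail v))
      (liftSum n ψ r ε f (k + 1) v) := by
  refine isWeakDerivH_of_eqOn_contDiff fun δ hδ => ?_
  obtain ⟨N, hN⟩ := exists_liftSum_eq_sum hψ r hε hε' f hδ
  have hs (i : ℕ) : ContDiff ℝ (⊤ : ℕ∞) (liftTerm n ψ r (ε i) (f i) (Fin.tail v)) :=
    contDiff_liftTerm hψs r (ε i) (hf i) _
  refine ⟨fun p => ∑ i ∈ Finset.range N, liftTerm n ψ r (ε i) (f i) (Fin.tail v) p,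
    ContDiff.sum fun i _ => (hs i).of_le (by exact_mod_cast le_top),
    fun p hp => ⟨hN _ _ p hp, ?_⟩⟩
  rw [hN _ _ p hp, fderiv_fun_sum fun i _ => (hs i).differentiable (by simp) p,
    sum_apply]
  exact Finset.sum_congr rfl fun i _ => (fderiv_liftTerm hψs r (ε i) (hf i) v p).symm

lemma continuousOn_liftSum {n : ℕ} {ψ : ℝ → ℝ} (hψs : ContDiff ℝ (⊤ : ℕ∞) ψ)
    (hψ : ∀ j s, 2 < s → iteratedDeriv j ψ s = 0) (r : ℕ) {ε : ℕ → ℝ}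
    (hε : ∀ i, 0 < ε i) (hε' : ∀ i : ℕ, ε i ≤ 1 / ((i : ℝ) + 1)) {f : ℕ → En n → ℝ}
    (hf : ∀ i, ContDiff ℝ (⊤ : ℕ∞) (f i)) {k : ℕ} (v : Fin k → Fin (n + 1)) :
    ContinuousOn (liftSum n ψ r ε f k v) (halfSpace n) := by
  intro p hp
  have hp2 : 0 < p.2 := hp.2
  obtain ⟨N, hN⟩ := exists_liftSum_eq_sum hψ r hε hε' f (half_pos hp2)
  refine ContinuousAt.continuousWithinAt ?_
  have hc : ContinuousAt
      (fun p => ∑ i ∈ Finset.range N, liftTerm n ψ r (ε i) (f i) v p) p :=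
    (continuous_finsetSum _ fun i _ =>
      (contDiff_liftTerm hψs r (ε i) (hf i) v).continuous).continuousAt
  refine hc.congr ?_
  filter_upwards [continuous_snd.continuousAt.eventually (lt_mem_nhds (half_lt_self hp2))]
    with q hq using (hN k v q (le_of_lt hq)).symm

lemma locallyIntegrableOn_liftSum {n : ℕ} {ψ : ℝ → ℝ} (hψs : ContDiff ℝ (⊤ : ℕ∞) ψ)
    (hψ : ∀ j s, 2 < s → iteratedDeriv j ψ s = 0) (r : ℕ) {ε : ℕ → ℝ}
    (hε : ∀ i, 0 < ε i) (hε' : ∀ i : ℕ, ε i ≤ 1 / ((i : ℝ) + 1)) {f : ℕ → En n → ℝ}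
    (hf : ∀ i, ContDiff ℝ (⊤ : ℕ∞) (f i)) {k : ℕ} (v : Fin k → Fin (n + 1)) :
    LocallyIntegrableOn (liftSum n ψ r ε f k v) (halfSpace n) := by
  have : IsLocallyFiniteMeasure (volume : Measure (En n × ℝ)) :=
    inferInstanceAs
      (IsLocallyFiniteMeasure ((volume : Measure (En n)).prod (volume : Measure ℝ)))
  exact (continuousOn_liftSum hψs hψ r hε hε' hf v).locallyIntegrableOn
    (MeasurableSet.univ.prod measurableSet_Ioi)

lemma lintegral_profileDeriv_le {ψ : ℝ → ℝ} (hψ : ∀ j s, 2 < s → iteratedDeriv j ψ s = 0)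
    (r k j : ℕ) {ε M : ℝ} (hε : 0 < ε) (hM : ∀ s, |iteratedDeriv j ψ s| ≤ M) :
    ∫⁻ t in Ioi (0 : ℝ), ENNReal.ofReal (t ^ k) * ‖profileDeriv ψ r ε j t‖ₑ ≤
      ENNReal.ofReal (2 ^ (k + 1) * M * (ε ^ (k + 1 + r) * ε⁻¹ ^ j)) := by
  have hM0 : 0 ≤ M := (abs_nonneg _).trans (hM 0)
  calc ∫⁻ t in Ioi (0 : ℝ), ENNReal.ofReal (t ^ k) * ‖profileDeriv ψ r ε j t‖ₑ
      ≤ ∫⁻ t in Ioi (0 : ℝ), (Iic (2 * ε)).indicator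
          (fun _ => ENNReal.ofReal ((2 * ε) ^ k * (ε ^ r * ε⁻¹ ^ j * M))) t := by
        refine setLIntegral_mono' measurableSet_Ioi fun t (ht : 0 < t) => ?_
        by_cases h2 : t ≤ 2 * ε
        · rw [indicator_of_mem (by exact h2), Real.enorm_eq_ofReal_abs,
            ← ENNReal.ofReal_mul (by positivity)]
          refine ENNReal.ofReal_le_ofReal ?_
          rw [profileDeriv, abs_mul, abs_of_nonneg (a := ε ^ r * ε⁻¹ ^ j) (by positivity)]
          gcongr
          exact hM _
        · rw [profileDeriv_eq_zero hψ r hε j (not_le.1 h2)]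
          simp
    _ = ENNReal.ofReal ((2 * ε) ^ k * (ε ^ r * ε⁻¹ ^ j * M)) * ENNReal.ofReal (2 * ε) := by
        rw [lintegral_indicator measurableSet_Iic, lintegral_const,
          Measure.restrict_restrict measurableSet_Iic, Measure.restrict_apply_univ,
          Iic_inter_Ioi, Real.volume_Ioc, sub_zero]
    _ = _ := by
        rw [← ENNReal.ofReal_mul (by positivity)]
        congr 1
        ring

lemma lintegral_liftTerm_le {n : ℕ} {ψ : ℝ → ℝ} (hψs : ContDiff ℝ (⊤ : ℕ∞) ψ)
    (hψ : ∀ j s, 2 < s → iteratedDeriv j ψ s = 0) (r k : ℕ) {ε M : ℝ} (hε : 0 < ε)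
    {f : En n → ℝ} (hf : ContDiff ℝ (⊤ : ℕ∞) f) {l : ℕ} (v : Fin l → Fin (n + 1))
    (hM : ∀ s, |iteratedDeriv (vertCount n v) ψ s| ≤ M) :
    ∫⁻ p in halfSpace n, ENNReal.ofReal (p.2 ^ k) * ‖liftTerm n ψ r ε f v p‖ₑ ≤
      ENNReal.ofReal (2 ^ (k + 1) * M * (ε ^ (k + 1 + r) * ε⁻¹ ^ vertCount n v)) *
        ∫⁻ x, ‖horizDeriv n v f x‖ₑ := by
  have hv : (volume : Measure (En n × ℝ)).restrict (halfSpace n) =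
      (volume : Measure (En n)).prod ((volume : Measure ℝ).restrict (Ioi 0)) := by
    rw [halfSpace, Measure.volume_eq_prod, ← Measure.prod_restrict, Measure.restrict_univ]
  have hm1 : Measurable fun x => ‖horizDeriv n v f x‖ₑ :=
    (contDiff_horizDeriv hf v).continuous.measurable.enorm
  have hm2 : Measurable fun t : ℝ =>
      ENNReal.ofReal (t ^ k) * ‖profileDeriv ψ r ε (vertCount n v) t‖ₑ :=
    (measurable_id.pow_const k).ennreal_ofReal.mul
      (contDiff_profileDeriv hψs r ε _).continuous.measurable.enorm
  have he (p : En n × ℝ) : ENNReal.ofReal (p.2 ^ k) * ‖liftTerm n ψ r ε f v p‖ₑ =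
      ‖horizDeriv n v f p.1‖ₑ *
        (ENNReal.ofReal (p.2 ^ k) * ‖profileDeriv ψ r ε (vertCount n v) p.2‖ₑ) := by
    rw [liftTerm, enorm_mul]
    ring
  simp_rw [he]
  rw [hv, lintegral_prod_mul hm1.aemeasurable hm2.aemeasurable, mul_comm]
  gcongr
  exact lintegral_profileDeriv_le hψ r k _ hε hM

lemma hasSum_sub_of_tendsto {h : ℕ → ℝ} {a : ℝ} (h0 : h 0 = 0)
    (hs : Summable fun i => ‖h (i + 1) - h i‖) (ht : Tendsto h atTop (𝓝 a)) :
    HasSum (fun i => h (i + 1) - h i) a := by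
  rw [hasSum_iff_tendsto_nat_of_summable_norm hs]
  simpa only [Finset.sum_range_sub, h0, sub_zero] using ht

/-- An integrable function is the almost everywhere sum of a series of smooth compactly supported
functions whose `L¹` norms have a sum controlled by that of the function. -/
lemma exists_smooth_series {n : ℕ} {g : En n → ℝ} (hg : Integrable g) :
    ∃ f : ℕ → En n → ℝ, (∀ i, ContDiff ℝ (⊤ : ℕ∞) (f i)) ∧ (∀ i, HasCompactSupport (f i)) ∧
      ∑' i, ∫⁻ x, ‖f i x‖ₑ ≤ 4 * ∫⁻ x, ‖g x‖ₑ ∧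
      ∀ᵐ x, HasSum (fun i => f i x) (g x) := by
  set δ : ℝ≥0∞ := ∫⁻ x, ‖g x‖ₑ with hδ
  have hδt : δ ≠ ⊤ := hg.hasFiniteIntegral.ne
  have hex (i : ℕ) : ∃ h : En n → ℝ, ContDiff ℝ (⊤ : ℕ∞) h ∧ HasCompactSupport h ∧
      ∫⁻ x, ‖h x - g x‖ₑ ≤ δ * 2⁻¹ ^ i ∧ (i = 0 → h = 0) := by
    by_cases hi : i = 0 ∨ δ = 0
    · refine ⟨0, contDiff_const, HasCompactSupport.zero, ?_, fun _ => rfl⟩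
      rcases hi with rfl | h0
      · simp [hδ]
      · simpa [h0] using hδ.symm.le.trans h0.le
    · push Not at hi
      have hpos : 0 < (δ * 2⁻¹ ^ i).toReal :=
        ENNReal.toReal_pos (mul_ne_zero hi.2 (by simp))
          (ENNReal.mul_ne_top hδt (ENNReal.pow_ne_top (by simp)))
      obtain ⟨h, h1, h2, h3⟩ := MemLp.exist_eLpNorm_sub_le (p := 1) (by simp) le_rfl
        (memLp_one_iff_integrable.2 hg) hpos
      refine ⟨h, h2, h1, ?_, fun h0 => absurd h0 hi.1⟩
      rw [eLpNorm_one_eq_lintegral_enorm, ENNReal.ofReal_toReal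
        (ENNReal.mul_ne_top hδt (ENNReal.pow_ne_top (by simp)))] at h3
      refine le_trans (le_of_eq (lintegral_congr fun x => ?_)) h3
      rw [Pi.sub_apply, enorm_sub_rev]
  choose h hh hc hle h0 using hex
  have hsum : ∑' i, δ * 2⁻¹ ^ i = δ * 2 := by
    rw [ENNReal.tsum_mul_left, ENNReal.tsum_geometric_two]
  have hm (i : ℕ) : AEMeasurable (fun x => ‖h i x - g x‖ₑ) volume :=
    ((hh i).continuous.aestronglyMeasurable.sub hg.aestronglyMeasurable).enorm
  have hfm (i : ℕ) : Measurable (fun x => ‖h (i + 1) x - h i x‖ₑ) :=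
    ((hh (i + 1)).continuous.sub (hh i).continuous).measurable.enorm
  have hfle (i : ℕ) : ∫⁻ x, ‖h (i + 1) x - h i x‖ₑ ≤ 2 * (δ * 2⁻¹ ^ i) := by
    calc ∫⁻ x, ‖h (i + 1) x - h i x‖ₑ
        ≤ ∫⁻ x, (‖h (i + 1) x - g x‖ₑ + ‖h i x - g x‖ₑ) :=
          lintegral_mono fun x => by
            rw [← sub_sub_sub_cancel_right _ _ (g x)]
            exact enorm_sub_le
      _ = (∫⁻ x, ‖h (i + 1) x - g x‖ₑ) + ∫⁻ x, ‖h i x - g x‖ₑ := lintegral_add_left' (hm _) _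
      _ ≤ δ * 2⁻¹ ^ i + δ * 2⁻¹ ^ i := by
          refine add_le_add ((hle (i + 1)).trans ?_) (hle i)
          gcongr δ * ?_
          exact pow_le_pow_right_of_le_one' (by simp) (Nat.le_succ i)
      _ = 2 * (δ * 2⁻¹ ^ i) := (two_mul _).symm
  have hf4 : ∑' i, ∫⁻ x, ‖h (i + 1) x - h i x‖ₑ ≤ 4 * δ := by
    refine (ENNReal.tsum_le_tsum hfle).trans (le_of_eq ?_)
    rw [ENNReal.tsum_mul_left, hsum]
    ring
  have a1 : ∀ᵐ x, ∑' i, ‖h (i + 1) x - h i x‖ₑ ≠ ⊤ := by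
    have : ∫⁻ x, ∑' i, ‖h (i + 1) x - h i x‖ₑ ≠ ⊤ := by
      rw [lintegral_tsum fun i => (hfm i).aemeasurable]
      exact ne_top_of_le_ne_top (ENNReal.mul_ne_top (by simp) hδt) hf4
    filter_upwards [ae_lt_top (Measurable.tsum hfm) this] with x hx using hx.ne
  have a2 : ∀ᵐ x, ∑' i, ‖h i x - g x‖ₑ ≠ ⊤ := by
    have : ∫⁻ x, ∑' i, ‖h i x - g x‖ₑ ≠ ⊤ := by
      rw [lintegral_tsum hm]
      refine ne_top_of_le_ne_top ?_ ((ENNReal.tsum_le_tsum hle).trans hsum.le)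
      exact ENNReal.mul_ne_top hδt (by simp)
    filter_upwards [ae_lt_top' (AEMeasurable.tsum hm) this] with x hx using hx.ne
  refine ⟨fun i x => h (i + 1) x - h i x, fun i => (hh (i + 1)).sub (hh i),
    fun i => (hc (i + 1)).sub (hc i), hf4, ?_⟩
  filter_upwards [a1, a2] with x h1 h2
  refine hasSum_sub_of_tendsto (h := fun i => h i x) (by simp [h0 0 rfl])
    (tsum_enorm_ne_top_iff_summable_norm.1 h1) ?_
  exact tendsto_sub_nhds_zero_iff.1
    (tsum_enorm_ne_top_iff_summable_norm.1 h2).of_norm.tendsto_atTop_zero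

lemma tendsto_lintegral_tsum_mul_sub {α : Type*} [MeasurableSpace α] {μ : Measure α}
    {f : ℕ → α → ℝ} {g : α → ℝ} (hf : ∀ i, AEMeasurable (f i) μ)
    (hsum : ∑' i, ∫⁻ x, ‖f i x‖ₑ ∂μ ≠ ⊤) (hg : ∀ᵐ x ∂μ, HasSum (fun i => f i x) (g x))
    {l : Filter ℝ} {c : ℕ → ℝ → ℝ} {a B : ℝ} (hc : ∀ i, Tendsto (c i) l (𝓝 a))
    (hB : ∀ i t, |c i t| ≤ B) :
    Tendsto (fun t => ∫⁻ x, ‖(∑' i, f i x * c i t) - a * g x‖ₑ ∂μ) l (𝓝 0) := by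
  have hfin (i : ℕ) : ∫⁻ x, ‖f i x‖ₑ ∂μ ≠ ⊤ := ENNReal.ne_top_of_tsum_ne_top hsum i
  have hle (t : ℝ) : ∫⁻ x, ‖(∑' i, f i x * c i t) - a * g x‖ₑ ∂μ ≤
      ENNReal.ofReal (∑' i, (∫⁻ x, ‖f i x‖ₑ ∂μ).toReal * |c i t - a|) := by
    have hs : Summable fun i => (∫⁻ x, ‖f i x‖ₑ ∂μ).toReal * |c i t - a| := by
      refine Summable.of_nonneg_of_le (fun i => by positivity) (fun i => ?_)
        ((ENNReal.summable_toReal hsum).mul_right (B + |a|))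
      gcongr
      exact (abs_sub _ _).trans (by gcongr; exact hB i t)
    rw [ENNReal.ofReal_tsum_of_nonneg (fun i => by positivity) hs]
    calc ∫⁻ x, ‖(∑' i, f i x * c i t) - a * g x‖ₑ ∂μ
        ≤ ∫⁻ x, ∑' i, ‖f i x * (c i t - a)‖ₑ ∂μ := by
          refine lintegral_mono_ae ?_
          filter_upwards [hg] with x hx
          have h1 : Summable fun i => f i x * c i t := by
            refine Summable.of_norm_bounded (hx.summable.norm.mul_right B) fun i => ?_
            rw [norm_mul]
            gcongr
            exact hB i t
          rw [← hx.tsum_eq, ← tsum_mul_left, ← h1.tsum_sub (hx.summable.mul_left a)]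
          refine le_trans (le_of_eq ?_) enorm_tsum_le_tsum_enorm
          congr 2 with i
          ring
      _ = ∑' i, ∫⁻ x, ‖f i x * (c i t - a)‖ₑ ∂μ :=
          lintegral_tsum fun i => ((hf i).mul_const _).enorm
      _ = _ := by
          congr 1 with i
          simp_rw [enorm_mul]
          rw [lintegral_mul_const' _ _ enorm_ne_top, ENNReal.ofReal_mul ENNReal.toReal_nonneg,
            ENNReal.ofReal_toReal (hfin i), Real.enorm_eq_ofReal_abs]
  have hlim : Tendsto (fun t => ∑' i, (∫⁻ x, ‖f i x‖ₑ ∂μ).toReal * |c i t - a|) l (𝓝 0) := by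
    have := tendsto_tsum_of_dominated_convergence (𝓕 := l)
      (f := fun t i => (∫⁻ x, ‖f i x‖ₑ ∂μ).toReal * |c i t - a|) (g := fun _ => (0 : ℝ))
      ((ENNReal.summable_toReal hsum).mul_right (B + |a|)) (fun i => ?_)
      (Eventually.of_forall fun t i => ?_)
    · simpa using this
    · have h1 : Tendsto (fun t => |c i t - a|) l (𝓝 0) := by
        simpa using ((hc i).sub_const a).abs
      simpa using h1.const_mul (∫⁻ x, ‖f i x‖ₑ ∂μ).toReal
    · rw [Real.norm_of_nonneg (by positivity)]
      gcongr
      exact (abs_sub _ _).trans (by gcongr; exact hB i t)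
  refine tendsto_of_tendsto_of_tendsto_of_le_of_le tendsto_const_nhds
    (by simpa using ENNReal.tendsto_ofReal hlim) (fun _ => zero_le) hle

lemma exists_scale_s13 {n : ℕ} {f : En n → ℝ} (hf : ContDiff ℝ (⊤ : ℕ∞) f)
    (hfc : HasCompactSupport f) (l : ℕ) {η : ℝ} (hη : 0 < η) :
    ∃ ε : ℝ, 0 < ε ∧ ε ≤ η ∧ ∀ v : Fin l → Fin (n + 1),
      ENNReal.ofReal ε * ∫⁻ x, ‖horizDeriv n v f x‖ₑ ≤ ∫⁻ x, ‖f x‖ₑ := by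
  have hlt (h : En n → ℝ) (hh : ContDiff ℝ (⊤ : ℕ∞) h) (hc : HasCompactSupport h) :
      ∫⁻ x, ‖h x‖ₑ ≠ ⊤ :=
    (hh.continuous.integrable_of_hasCompactSupport hc (μ := volume)).hasFiniteIntegral.ne
  by_cases h0 : ∫⁻ x, ‖f x‖ₑ = 0
  · rw [lintegral_eq_zero_iff hf.continuous.measurable.enorm] at h0
    have hf0 : f = 0 := by
      refine (hf.continuous.ae_eq_iff_eq volume continuous_const).1 ?_
      filter_upwards [h0] with x hx using enorm_eq_zero.1 hx
    refine ⟨η, hη, le_rfl, fun v => ?_⟩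
    simp [hf0, horizDeriv_zero]
  · set A : ℝ := (∫⁻ x, ‖f x‖ₑ).toReal
    have hA : 0 < A := ENNReal.toReal_pos h0 (hlt f hf hfc)
    set S : ℝ := ∑ v : Fin l → Fin (n + 1), (∫⁻ x, ‖horizDeriv n v f x‖ₑ).toReal
    have hS : 0 ≤ S := Finset.sum_nonneg fun _ _ => ENNReal.toReal_nonneg
    refine ⟨min η (A / (S + 1)), lt_min hη (by positivity), min_le_left _ _, fun v => ?_⟩
    have hv : (∫⁻ x, ‖horizDeriv n v f x‖ₑ).toReal ≤ S :=
      Finset.single_le_sum (f := fun v : Fin l → Fin (n + 1) =>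
        (∫⁻ x, ‖horizDeriv n v f x‖ₑ).toReal) (fun _ _ => ENNReal.toReal_nonneg)
        (Finset.mem_univ v)
    rw [← ENNReal.ofReal_toReal (hlt _ (contDiff_horizDeriv hf v)
      (hasCompactSupport_horizDeriv hfc v)), ← ENNReal.ofReal_toReal (hlt f hf hfc),
      ← ENNReal.ofReal_mul (by positivity)]
    refine ENNReal.ofReal_le_ofReal ?_
    calc min η (A / (S + 1)) * (∫⁻ x, ‖horizDeriv n v f x‖ₑ).toReal
        ≤ A / (S + 1) * (S + 1) := by
          gcongr
          · exact min_le_right _ _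
          · linarith
      _ = A := div_mul_cancel₀ _ (by positivity)

lemma sqrt_sum_sq_le_sum_abs {ι : Type*} (s : Finset ι) (a : ι → ℝ) :
    Real.sqrt (∑ i ∈ s, a i ^ 2) ≤ ∑ i ∈ s, |a i| := by
  refine Real.sqrt_le_iff.2 ⟨Finset.sum_nonneg fun _ _ => abs_nonneg _, ?_⟩
  simpa only [sq_abs] using Finset.sum_sq_le_sq_sum_of_nonneg fun i (_ : i ∈ s) => abs_nonneg (a i)

lemma lintegral_liftTerm_le_of_scale {n : ℕ} {ψ : ℝ → ℝ} (hψs : ContDiff ℝ (⊤ : ℕ∞) ψ)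
    (hψ : ∀ j s, 2 < s → iteratedDeriv j ψ s = 0) {m k : ℕ} (hk : k ≤ m) {ε M : ℝ} (hε : 0 < ε)
    (hε1 : ε ≤ 1) {f : En n → ℝ} (hf : ContDiff ℝ (⊤ : ℕ∞) f)
    (v : Fin (m + 1) → Fin (n + 1))
    (hεv : ENNReal.ofReal ε * ∫⁻ x, ‖horizDeriv n v f x‖ₑ ≤ ∫⁻ x, ‖f x‖ₑ)
    (hM : ∀ s, |iteratedDeriv (vertCount n v) ψ s| ≤ M) :
    ∫⁻ p in halfSpace n, ENNReal.ofReal (p.2 ^ k) * ‖liftTerm n ψ (m - k) ε f v p‖ₑ ≤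
      ENNReal.ofReal (2 ^ (k + 1) * M) * ∫⁻ x, ‖f x‖ₑ := by
  have hM0 : 0 ≤ M := (abs_nonneg _).trans (hM 0)
  refine (lintegral_liftTerm_le hψs hψ (m - k) k hε hf v hM).trans ?_
  rw [ENNReal.ofReal_mul (by positivity), mul_assoc]
  gcongr
  rw [show k + 1 + (m - k) = m + 1 by omega]
  rcases (vertCount_le v).eq_or_lt with hb | hb
  · rw [hb, horizDeriv_of_vertCount_eq f v hb, ← mul_pow, mul_inv_cancel₀ hε.ne', one_pow,
      ENNReal.ofReal_one, one_mul]
  · refine le_trans ?_ hεv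
    gcongr
    rw [inv_pow, ← pow_sub₀ _ hε.ne' hb.le]
    exact pow_le_of_le_one hε.le hε1 (Nat.sub_ne_zero_of_lt hb)

lemma lintegral_liftSum_le {n m k : ℕ} (hk : k ≤ m) {ψ : ℝ → ℝ} (hψs : ContDiff ℝ (⊤ : ℕ∞) ψ)
    (hψ : ∀ j s, 2 < s → iteratedDeriv j ψ s = 0) {ε : ℕ → ℝ} {M : ℝ}
    (hε : ∀ i, 0 < ε i) (hε1 : ∀ i, ε i ≤ 1) {f : ℕ → En n → ℝ}
    (hf : ∀ i, ContDiff ℝ (⊤ : ℕ∞) (f i))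
    (hεv : ∀ i (v : Fin (m + 1) → Fin (n + 1)),
      ENNReal.ofReal (ε i) * ∫⁻ x, ‖horizDeriv n v (f i) x‖ₑ ≤ ∫⁻ x, ‖f i x‖ₑ)
    (hM : ∀ j ≤ m + 1, ∀ s, |iteratedDeriv j ψ s| ≤ M) :
    ∫⁻ p in halfSpace n, ENNReal.ofReal (p.2 ^ k * Real.sqrt
        (∑ v : Fin (m + 1) → Fin (n + 1), liftSum n ψ (m - k) ε f (m + 1) v p ^ 2)) ≤
      ENNReal.ofReal ((n + 1) ^ (m + 1) * (2 ^ (k + 1) * M)) * ∑' i, ∫⁻ x, ‖f i x‖ₑ := by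
  have hmeas (i : ℕ) (v : Fin (m + 1) → Fin (n + 1)) : Measurable fun p : En n × ℝ =>
      ENNReal.ofReal (p.2 ^ k) * ‖liftTerm n ψ (m - k) (ε i) (f i) v p‖ₑ :=
    (measurable_snd.pow_const k).ennreal_ofReal.mul
      (contDiff_liftTerm hψs _ _ (hf i) v).continuous.measurable.enorm
  calc _ ≤ ∫⁻ p in halfSpace n, ∑ v : Fin (m + 1) → Fin (n + 1),
        ∑' i, ENNReal.ofReal (p.2 ^ k) * ‖liftTerm n ψ (m - k) (ε i) (f i) v p‖ₑ := by
        refine setLIntegral_mono' (MeasurableSet.univ.prod measurableSet_Ioi) fun p hp => ?_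
        have hp2 : 0 < p.2 := hp.2
        rw [ENNReal.ofReal_mul (by positivity)]
        simp_rw [ENNReal.tsum_mul_left]
        rw [← Finset.mul_sum]
        gcongr
        refine (ENNReal.ofReal_le_ofReal (sqrt_sum_sq_le_sum_abs _ _)).trans ?_
        rw [ENNReal.ofReal_sum_of_nonneg fun _ _ => abs_nonneg _]
        refine Finset.sum_le_sum fun v _ => ?_
        rw [← Real.enorm_eq_ofReal_abs]
        exact enorm_tsum_le_tsum_enorm
    _ = ∑ v : Fin (m + 1) → Fin (n + 1), ∑' i, ∫⁻ p in halfSpace n,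
          ENNReal.ofReal (p.2 ^ k) * ‖liftTerm n ψ (m - k) (ε i) (f i) v p‖ₑ := by
        rw [lintegral_finsetSum _ fun v _ => Measurable.tsum fun i => hmeas i v]
        exact Finset.sum_congr rfl fun v _ => lintegral_tsum fun i => (hmeas i v).aemeasurable
    _ ≤ ∑ v : Fin (m + 1) → Fin (n + 1), ∑' i,
          ENNReal.ofReal (2 ^ (k + 1) * M) * ∫⁻ x, ‖f i x‖ₑ :=
        Finset.sum_le_sum fun v _ => ENNReal.tsum_le_tsum fun i =>
          lintegral_liftTerm_le_of_scale hψs hψ hk (hε i) (hε1 i) (hf i) v (hεv i v)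
            (hM _ (vertCount_le v))
    _ = _ := by
        have hcard : ENNReal.ofReal ((n + 1) ^ (m + 1)) = ((n + 1) ^ (m + 1) : ℕ) := by
          rw [← ENNReal.ofReal_natCast]
          norm_cast
        rw [Finset.sum_const, ENNReal.tsum_mul_left,
          ENNReal.ofReal_mul (p := (n + 1) ^ (m + 1)) (by positivity), hcard]
        simp [mul_assoc]

lemma tendsto_lintegral_liftSum_sub {n : ℕ} {ψ : ℝ → ℝ} (hψs : ContDiff ℝ (⊤ : ℕ∞) ψ)
    {r j : ℕ} (hj : j ≤ r) {a : ℝ} (ha : iteratedDeriv j ψ 0 = a) (har : j < r → a = 0)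
    {M : ℝ} (hM : ∀ s, |iteratedDeriv j ψ s| ≤ M)
    {ε : ℕ → ℝ} (hε : ∀ i, 0 < ε i) (hε1 : ∀ i, ε i ≤ 1) {f : ℕ → En n → ℝ}
    (hf : ∀ i, ContDiff ℝ (⊤ : ℕ∞) (f i)) {g : En n → ℝ}
    (hsum : ∑' i, ∫⁻ x, ‖f i x‖ₑ ≠ ⊤) (hg : ∀ᵐ x, HasSum (fun i => f i x) (g x)) :
    Tendsto (fun t : ℝ => ∫⁻ x, ENNReal.ofReal
      |liftSum n ψ r ε f j (fun _ => Fin.last n) (x, t) - a * g x|) (𝓝[>] 0) (𝓝 0) := by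
  have hpow (i : ℕ) : ε i ^ r * (ε i)⁻¹ ^ j = ε i ^ (r - j) := by
    rw [pow_sub₀ _ (hε i).ne' hj, inv_pow]
  have hc (i : ℕ) : Tendsto (profileDeriv ψ r (ε i) j) (𝓝[>] 0) (𝓝 a) := by
    have h1 := ((contDiff_profileDeriv hψs r (ε i) j).continuous.tendsto 0).mono_left
      (nhdsWithin_le_nhds (s := Ioi 0))
    convert h1 using 2
    rw [profileDeriv, mul_zero, ha, hpow]
    rcases hj.eq_or_lt with rfl | h
    · simp
    · simp [har h]
  have hB (i : ℕ) (t : ℝ) : |profileDeriv ψ r (ε i) j t| ≤ M := by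
    have h1 : 0 ≤ ε i ^ (r - j) := pow_nonneg (hε i).le _
    rw [profileDeriv, hpow, abs_mul, abs_of_nonneg h1]
    exact (mul_le_of_le_one_left (abs_nonneg _) (pow_le_one₀ (hε i).le (hε1 i))).trans (hM _)
  have h := tendsto_lintegral_tsum_mul_sub (fun i => (hf i).continuous.aemeasurable)
    hsum hg hc hB
  simpa only [liftSum, liftTerm, horizDeriv_of_vertCount_eq _ _ (vertCount_const_last n j),
    vertCount_const_last, ← Real.enorm_eq_ofReal_abs] using h

/-- Lemma `lemma normal L1`: for `k < m` and `g ∈ L¹(ℝⁿ)` there is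
`G ∈ W^{m+1,1}_loc(ℝ₊^{n+1})` (weak derivative data `DG`) with
`∫ t^k |∇^{m+1} G| ≤ C ‖g‖_{L¹}`, vanishing traces `∂_t^j G → 0` for
`j = 0,…,m-k-1`, and `∂_t^{m-k} G → g` in `L¹` as `t → 0⁺`. -/
theorem lifting_normal_derivative_L1 (n m k : ℕ) (hn : 0 < n) (hm : 0 < m)
    (hk : k < m) :
    ∃ C : ℝ, 0 < C ∧
      ∀ g : En n → ℝ, Integrable g →
        ∃ (G : En n × ℝ → ℝ) (DG : (kk : ℕ) → (Fin kk → Fin (n + 1)) → En n × ℝ → ℝ),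
          WeakDerivsH n m G DG ∧
          (∀ kk, kk ≤ m + 1 → ∀ v : Fin kk → Fin (n + 1),
            LocallyIntegrableOn (DG kk v) (halfSpace n)) ∧
          (∫⁻ p in halfSpace n,
              ENNReal.ofReal (p.2 ^ (k : ℕ) * Real.sqrt
                (∑ v : Fin (m + 1) → Fin (n + 1), (DG (m + 1) v p) ^ 2))) ≤
            ENNReal.ofReal C * (∫⁻ x, ENNReal.ofReal |g x|) ∧
          (∀ j, j ≤ m - k - 1 →
            Tendsto (fun t : ℝ =>
                ∫⁻ x, ENNReal.ofReal |DG j (fun _ => Fin.last n) (x, t)|)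
              (𝓝[>] 0) (𝓝 0)) ∧
          Tendsto (fun t : ℝ =>
              ∫⁻ x, ENNReal.ofReal |DG (m - k) (fun _ => Fin.last n) (x, t) - g x|)
            (𝓝[>] 0) (𝓝 0) := by
  obtain ⟨ψ, hψs, hψ, hψ0, hψb⟩ := exists_profile (m - k)
  choose M hM using hψb
  set B : ℝ := 1 + ∑ j ∈ Finset.range (m + 2), M j
  have hM0 (j : ℕ) : 0 ≤ M j := (abs_nonneg _).trans (hM j 0)
  have hB : 0 < B := by
    have : 0 ≤ ∑ j ∈ Finset.range (m + 2), M j := Finset.sum_nonneg fun j _ => hM0 j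
    positivity
  have hMB : ∀ j ≤ m + 1, ∀ s, |iteratedDeriv j ψ s| ≤ B := by
    intro j hj s
    have := Finset.single_le_sum (f := M) (s := Finset.range (m + 2)) (fun j _ => hM0 j)
      (Finset.mem_range.2 (Nat.lt_succ_of_le hj))
    linarith [hM j s]
  refine ⟨(n + 1) ^ (m + 1) * (2 ^ (k + 1) * B) * 4, by positivity, fun g hg => ?_⟩
  obtain ⟨f, hf, hfc, hf4, hfg⟩ := exists_smooth_series hg
  have hsum : ∑' i, ∫⁻ x, ‖f i x‖ₑ ≠ ⊤ :=
    ne_top_of_le_ne_top (ENNReal.mul_ne_top (by simp) hg.hasFiniteIntegral.ne) hf4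
  choose ε hε hεi hεv using fun i : ℕ =>
    exists_scale_s13 (hf i) (hfc i) (m + 1) (Nat.one_div_pos_of_nat (α := ℝ) (n := i))
  have hε1 (i : ℕ) : ε i ≤ 1 :=
    (hεi i).trans (div_le_one_of_le₀ (by linarith [(Nat.cast_nonneg i : (0 : ℝ) ≤ i)])
      (by positivity))
  refine ⟨liftSum n ψ (m - k) ε f 0 Fin.elim0, liftSum n ψ (m - k) ε f,
    ⟨rfl, fun l _ v => isWeakDerivH_liftSum hψs hψ _ hε hεi hf v⟩,
    fun l _ v => locallyIntegrableOn_liftSum hψs hψ _ hε hεi hf v, ?_, fun j hj => ?_, ?_⟩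
  · refine (lintegral_liftSum_le hk.le hψs hψ hε hε1 hf hεv hMB).trans ?_
    simp_rw [← Real.enorm_eq_ofReal_abs]
    rw [ENNReal.ofReal_mul (q := 4) (by positivity), mul_assoc _ (ENNReal.ofReal 4),
      ENNReal.ofReal_ofNat]
    gcongr
  · have hj' : j < m - k := by omega
    simpa using tendsto_lintegral_liftSum_sub hψs hj'.le (a := 0)
      (by rw [hψ0 j hj'.le, if_neg hj'.ne]) (fun _ => rfl) (hM j) hε hε1 hf hsum hfg
  · simpa using tendsto_lintegral_liftSum_sub hψs le_rfl (a := 1)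
      (by rw [hψ0 _ le_rfl, if_pos rfl]) (fun h => absurd h (lt_irrefl _)) (hM _) hε hε1 hf
      hsum hfg

end
end

section
/- Let n ∈ ℕ, j ∈ {1,…,n} and t > 0. Then for every x ∈ ℝⁿ, the Riesz transform of ∂P_t/∂t equals ∂P_t/∂x_j at x; that is, lim_{ε→0⁺} c_n ∫_{|y|>ε} (∂P_t/∂t)(x−y) · y_j/|y|^{n+1} dy = (∂P_t/∂x_j)(x), where c_n := Γ((n+1)/2) / π^{(n+1)/2}. -/
open MeasureTheory Filter Set
open scoped ENNReal NNReal Topology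

noncomputable section

/-- The constant `c_n = Γ((n+1)/2) / π^{(n+1)/2}` of the Poisson kernel. -/
def poisC (n : ℕ) : ℝ := Real.Gamma (((n : ℝ) + 1) / 2) / Real.pi ^ (((n : ℝ) + 1) / 2)

/-- The Poisson kernel `P_t(x) = c_n t / (|x|² + t²)^{(n+1)/2}`. -/
def poisP (n : ℕ) (t : ℝ) (x : En n) : ℝ :=
  poisC n * t / (‖x‖ ^ 2 + t ^ 2) ^ (((n : ℝ) + 1) / 2)

/-- The harmonic (Poisson) extension `u(x,t) = (P_t * f)(x)`. -/
def poisExt (n : ℕ) (f : En n → ℝ) (x : En n) (t : ℝ) : ℝ :=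
  ∫ y, poisP n t (x - y) * f y

/-- Mellin representation of a negative power, integrated against a nonnegative weight. -/
theorem Gamma_mul_integral_rpow_neg {X : Type*} [MeasurableSpace X] {μ : Measure X} [SFinite μ]
    {p : ℝ} (hp : 0 < p) {w f : X → ℝ} (hw : ∀ᵐ z ∂μ, 0 ≤ w z) (hf : ∀ᵐ z ∂μ, 0 < f z)
    (hwm : Measurable w) (hfm : Measurable f)
    (hi : Integrable (fun z => w z * f z ^ (-p)) μ) :
    Real.Gamma p * ∫ z, w z * f z ^ (-p) ∂μ =
      ∫ l in Ioi (0 : ℝ), l ^ (p - 1) * ∫ z, w z * Real.exp (-(f z * l)) ∂μ := by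
  have key : ∀ z, 0 < f z →
      ∫ l in Ioi (0 : ℝ), l ^ (p - 1) * (w z * Real.exp (-(f z * l))) =
        Real.Gamma p * (w z * f z ^ (-p)) := by
    intro z hz
    have h := Real.integral_rpow_mul_exp_neg_mul_Ioi hp hz
    rw [one_div, Real.inv_rpow hz.le, ← Real.rpow_neg hz.le] at h
    calc _ = ∫ l in Ioi (0 : ℝ), w z * (l ^ (p - 1) * Real.exp (-(f z * l))) := by
          congr 1; ext l; ring
      _ = _ := by rw [integral_const_mul, h]; ring
  have hint : ∀ z, 0 < f z →
      Integrable (fun l => l ^ (p - 1) * (w z * Real.exp (-(f z * l))))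
        (volume.restrict (Ioi (0 : ℝ))) := by
    intro z hz
    have h := integrableOn_rpow_mul_exp_neg_mul_rpow (p := 1) (s := p - 1) (b := f z)
      (by linarith) one_pos hz
    refine (h.const_mul (w z)).congr (Eventually.of_forall fun l => ?_)
    simp only [Real.rpow_one, neg_mul]; ring
  rw [← integral_const_mul]
  calc _ = ∫ z, (∫ l in Ioi (0 : ℝ), l ^ (p - 1) * (w z * Real.exp (-(f z * l)))) ∂μ :=
        integral_congr_ae (by filter_upwards [hf] with z hz using (key z hz).symm)
    _ = ∫ l in Ioi (0 : ℝ), (∫ z, l ^ (p - 1) * (w z * Real.exp (-(f z * l))) ∂μ) := by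
        apply integral_integral_swap
        rw [integrable_prod_iff]
        · refine ⟨by filter_upwards [hf] with z hz using hint z hz, ?_⟩
          refine (hi.const_mul (Real.Gamma p)).congr ?_
          filter_upwards [hf, hw] with z hz hwz
          rw [← key z hz]
          refine setIntegral_congr_fun measurableSet_Ioi fun l hl => ?_
          have hl' : (0 : ℝ) < l := hl
          simp only [Function.uncurry]
          rw [Real.norm_of_nonneg (by positivity)]
        · apply Measurable.aestronglyMeasurable
          simp only [Function.uncurry_def]
          fun_prop
    _ = _ := by simp only [integral_const_mul]

theorem integrable_mul_norm_sq_add_rpow_neg {E : Type*} [NormedAddCommGroup E]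
    [InnerProductSpace ℝ E] [FiniteDimensional ℝ E] [MeasurableSpace E] [BorelSpace E]
    {α β p : ℝ} (hα : 0 < α) (hβ : 0 < β) (hp : (Module.finrank ℝ E : ℝ) / 2 < p) :
    Integrable (fun z : E => (α * ‖z‖ ^ 2 + β) ^ (-p)) := by
  have h := integrable_rpow_neg_one_add_norm_sq (E := E) (μ := volume) (r := 2 * p) (by linarith)
  have hp0 : 0 ≤ p := le_trans (by positivity) hp.le
  refine Integrable.mono' (h.const_mul (min α β ^ (-p))) ?_ (Eventually.of_forall fun z => ?_)
  · exact Measurable.aestronglyMeasurable (by fun_prop)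
  · have hm : 0 < min α β := lt_min hα hβ
    rw [Real.norm_of_nonneg (by positivity), show -(2 * p) / 2 = -p by ring,
      ← Real.mul_rpow hm.le (by positivity)]
    refine Real.rpow_le_rpow_of_nonpos (by positivity) ?_ (by linarith)
    nlinarith [min_le_left α β, min_le_right α β, sq_nonneg ‖z‖,
      mul_le_mul_of_nonneg_right (min_le_left α β) (sq_nonneg ‖z‖)]

theorem Gamma_mul_integral_mul_norm_sq_add_rpow_neg {E : Type*} [NormedAddCommGroup E]
    [InnerProductSpace ℝ E] [FiniteDimensional ℝ E] [MeasurableSpace E] [BorelSpace E]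
    {α β p : ℝ} (hα : 0 < α) (hβ : 0 < β) (hp : (Module.finrank ℝ E : ℝ) / 2 < p) :
    Real.Gamma p * ∫ z : E, (α * ‖z‖ ^ 2 + β) ^ (-p) =
      (Real.pi / α) ^ ((Module.finrank ℝ E : ℝ) / 2) *
        (β ^ ((Module.finrank ℝ E : ℝ) / 2 - p) *
          Real.Gamma (p - (Module.finrank ℝ E : ℝ) / 2)) := by
  set m : ℝ := (Module.finrank ℝ E : ℝ) / 2 with hm
  have hm0 : 0 ≤ m := by positivity
  have h := Gamma_mul_integral_rpow_neg (μ := (volume : Measure E)) (p := p) (w := fun _ => 1)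
    (f := fun z => α * ‖z‖ ^ 2 + β) (by linarith)
    (Eventually.of_forall fun _ => zero_le_one)
    (Eventually.of_forall fun _ => by positivity) (by fun_prop) (by fun_prop)
    (by simpa using integrable_mul_norm_sq_add_rpow_neg hα hβ hp)
  simp only [one_mul] at h
  rw [h]
  have hG := Real.integral_rpow_mul_exp_neg_mul_Ioi (a := p - m) (by linarith) hβ
  rw [one_div, Real.inv_rpow hβ.le, ← Real.rpow_neg hβ.le, neg_sub] at hG
  rw [← hG, ← integral_const_mul]
  refine setIntegral_congr_fun measurableSet_Ioi fun l hl => ?_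
  have hl' : (0 : ℝ) < l := hl
  have h1 : ∫ z : E, Real.exp (-((α * ‖z‖ ^ 2 + β) * l)) =
      Real.exp (-(β * l)) * (Real.pi / (α * l)) ^ m := by
    rw [hm, ← GaussianFourier.integral_rexp_neg_mul_sq_norm (by positivity), ← integral_const_mul]
    refine integral_congr_ae (Eventually.of_forall fun z => ?_)
    simp only [← Real.exp_add]
    ring_nf
  simp only [h1]
  rw [← div_div, Real.div_rpow (by positivity) hl'.le, show p - m - 1 = (p - 1) - m by ring,
    Real.rpow_sub hl' (p - 1) m]
  ring

/-- Feynman's parametrisation of a product of two equal negative powers. -/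
theorem Gamma_mul_integral_feynman {a A B : ℝ} (ha : 1 ≤ a) (hA : 0 < A) (hB : 0 < B) :
    IntegrableOn (fun v => v ^ (a - 1) * (A + v * B) ^ (-(2 * a))) (Ioi 0) ∧
    Real.Gamma (2 * a) * ∫ v in Ioi (0 : ℝ), v ^ (a - 1) * (A + v * B) ^ (-(2 * a)) =
      Real.Gamma a ^ 2 * (A ^ (-a) * B ^ (-a)) := by
  have hi : IntegrableOn (fun v => v ^ (a - 1) * (A + v * B) ^ (-(2 * a))) (Ioi 0) := by
    have h0 := (integrableOn_add_rpow_Ioi_of_lt (a := -(a+1)) (c := 0) (m := A / B)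
      (by linarith) (by simpa using div_pos hA hB))
    refine Integrable.mono' (h0.const_mul (B ^ (-(2 * a))))
      (Measurable.aestronglyMeasurable (by fun_prop)) ?_
    filter_upwards [ae_restrict_mem measurableSet_Ioi] with v hv
    have hv' : (0 : ℝ) < v := hv
    have hAB : 0 < A / B := div_pos hA hB
    rw [Real.norm_of_nonneg (by positivity), show A + v * B = B * (v + A / B) by field_simp; ring,
      Real.mul_rpow hB.le (by positivity), show -(a + 1) = (a - 1) + (-(2 * a)) by ring,
      Real.rpow_add (by positivity)]
    have : v ^ (a - 1) ≤ (v + A / B) ^ (a - 1) :=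
      Real.rpow_le_rpow hv'.le (by linarith) (by linarith)
    calc _ = v ^ (a - 1) * (B ^ (-(2 * a)) * (v + A / B) ^ (-(2 * a))) := rfl
      _ ≤ (v + A / B) ^ (a - 1) * (B ^ (-(2 * a)) * (v + A / B) ^ (-(2 * a))) := by gcongr
      _ = _ := by ring
  refine ⟨hi, ?_⟩
  rw [Gamma_mul_integral_rpow_neg (by linarith) ?_ ?_ (by fun_prop) (by fun_prop) hi]
  · have hG := Real.integral_rpow_mul_exp_neg_mul_Ioi (a := a) (by linarith) hA
    rw [one_div, Real.inv_rpow hA.le, ← Real.rpow_neg hA.le] at hG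
    rw [show Real.Gamma a ^ 2 * (A ^ (-a) * B ^ (-a)) =
      (Real.Gamma a * B ^ (-a)) * (A ^ (-a) * Real.Gamma a) by ring, ← hG, ← integral_const_mul]
    refine setIntegral_congr_fun measurableSet_Ioi fun l hl => ?_
    have hl' : (0 : ℝ) < l := hl
    have hG' := Real.integral_rpow_mul_exp_neg_mul_Ioi (a := a) (r := B * l) (by linarith)
      (by positivity)
    rw [one_div, Real.inv_rpow (by positivity), ← Real.rpow_neg (by positivity),
      Real.mul_rpow hB.le hl'.le] at hG'
    have h1 : ∫ v in Ioi (0 : ℝ), v ^ (a - 1) * Real.exp (-((A + v * B) * l)) =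
        Real.exp (-(A * l)) * (B ^ (-a) * l ^ (-a) * Real.Gamma a) := by
      rw [← hG', ← integral_const_mul]
      refine integral_congr_ae (Eventually.of_forall fun v => ?_)
      simp only
      rw [mul_left_comm, ← Real.exp_add]
      ring_nf
    simp only [h1]
    rw [show a - 1 = (2 * a - 1) + (-a) by ring, Real.rpow_add hl' (2 * a - 1) (-a)]
    ring
  · filter_upwards [ae_restrict_mem measurableSet_Ioi] with v hv
    exact Real.rpow_nonneg (le_of_lt hv) _
  · filter_upwards [ae_restrict_mem measurableSet_Ioi] with v hv
    have hv' : (0 : ℝ) < v := hv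
    positivity

/-- The Cauchy–Schlömilch substitution. -/
theorem integral_Ioi_cauchy_schlomilch {s t : ℝ} (hs : 0 < s) (ht : 0 < t) {F : ℝ → ℝ}
    (hF : Integrable fun u : ℝ => F (u ^ 2 + 2 * s * t)) :
    ∫ v in Ioi (0 : ℝ), v ^ (-(1 / 2) : ℝ) * F (s ^ 2 / v + t ^ 2 * v) =
      t⁻¹ * ∫ u : ℝ, F (u ^ 2 + 2 * s * t) := by
  have hst : 0 < s * t := mul_pos hs ht
  set r : ℝ → ℝ := fun u => √(u ^ 2 + 4 * (s * t)) with hr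
  have hr0 : ∀ u, 0 < r u := fun u => Real.sqrt_pos.2 (by positivity)
  have hr2 : ∀ u, r u ^ 2 = u ^ 2 + 4 * (s * t) := fun u => Real.sq_sqrt (by positivity)
  have hru : ∀ u, |u| < r u := fun u => abs_lt_of_sq_lt_sq (by rw [hr2]; linarith) (hr0 u).le
  set w : ℝ → ℝ := fun u => (u + r u) / (2 * t) with hw
  have hw0 : ∀ u, 0 < w u := fun u =>
    div_pos (by linarith [neg_abs_le u, hru u]) (by positivity)
  have hroot : ∀ u, t * w u - s / w u = u := by
    intro u
    have h : t * w u ^ 2 - u * w u - s = 0 := by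
      simp only [hw]; field_simp; nlinarith [hr2 u]
    have := (hw0 u).ne'
    field_simp
    linarith
  have hrd : ∀ u, HasDerivAt r (u / r u) u := by
    intro u
    have h : HasDerivAt (fun u : ℝ => u ^ 2 + 4 * (s * t)) (2 * u) u := by
      simpa using (hasDerivAt_pow 2 u).add_const (4 * (s * t))
    refine (h.sqrt (by positivity)).congr_deriv ?_
    change 2 * u / (2 * r u) = _
    rw [mul_div_mul_left _ _ two_ne_zero]
  have hwd : ∀ u, HasDerivAt w (w u / r u) u := by
    intro u
    refine (((hasDerivAt_id u).add (hrd u)).div_const (2 * t)).congr_deriv ?_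
    have := (hr0 u).ne'
    simp only [hw]; field_simp; ring
  have hderiv : ∀ u ∈ (univ : Set ℝ),
      HasDerivWithinAt (fun u => w u ^ 2) (2 * w u ^ 2 / r u) univ u := by
    intro u _
    refine (((hwd u).pow 2).congr_deriv ?_).hasDerivWithinAt
    simp; ring
  have hinj : InjOn (fun u => w u ^ 2) univ := by
    intro u _ u' _ h
    have : w u = w u' := by
      rwa [← sq_eq_sq₀ (hw0 u).le (hw0 u').le]
    rw [← hroot u, ← hroot u', this]
  have himg : (fun u => w u ^ 2) '' univ = Ioi 0 := by
    ext v
    simp only [image_univ, mem_range, mem_Ioi]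
    constructor
    · rintro ⟨u, rfl⟩; have := hw0 u; positivity
    · intro hv
      refine ⟨t * √v - s / √v, ?_⟩
      have hv' : 0 < √v := Real.sqrt_pos.2 hv
      have : r (t * √v - s / √v) = t * √v + s / √v := by
        rw [← sq_eq_sq₀ (hr0 _).le (by positivity), hr2]
        field_simp; ring
      simp only [hw, this]
      rw [← Real.sq_sqrt hv.le, Real.sqrt_sq hv'.le]
      field_simp; ring
  rw [← himg, integral_image_eq_integral_abs_deriv_smul MeasurableSet.univ hderiv hinj,
    setIntegral_univ]
  have hpt : ∀ u, |2 * w u ^ 2 / r u| •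
      ((w u ^ 2) ^ (-(1 / 2) : ℝ) * F (s ^ 2 / w u ^ 2 + t ^ 2 * w u ^ 2)) =
      t⁻¹ * F (u ^ 2 + 2 * s * t) + t⁻¹ * (u / r u * F (u ^ 2 + 2 * s * t)) := by
    intro u
    have h1 := hw0 u
    have h2 := hr0 u
    have harg : s ^ 2 / w u ^ 2 + t ^ 2 * w u ^ 2 = u ^ 2 + 2 * s * t := by
      conv_rhs => rw [← hroot u]
      field_simp; ring
    rw [harg, abs_of_pos (by positivity), Real.rpow_neg (by positivity), ← Real.sqrt_eq_rpow,
      Real.sqrt_sq h1.le, smul_eq_mul]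
    have h3 : 2 * w u = t⁻¹ * (u + r u) := by simp only [hw]; field_simp
    calc _ = (2 * w u) * ((r u)⁻¹ * F (u ^ 2 + 2 * s * t)) := by field_simp
      _ = _ := by rw [h3]; field_simp; ring
  simp only [hpt]
  have hodd : ∫ u, u / r u * F (u ^ 2 + 2 * s * t) = 0 := by
    have h := integral_neg_eq_self (fun u => u / r u * F (u ^ 2 + 2 * s * t)) volume
    have h' : ∀ u, -u / r (-u) * F ((-u) ^ 2 + 2 * s * t) =
        -(u / r u * F (u ^ 2 + 2 * s * t)) := by
      intro u
      simp only [hr, neg_sq]; ring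
    simp only [h', integral_neg] at h
    linarith
  have hint : Integrable fun u => u / r u * F (u ^ 2 + 2 * s * t) := by
    refine hF.bdd_mul (c := 1) (Measurable.aestronglyMeasurable (by fun_prop))
      (Eventually.of_forall fun u => ?_)
    rw [norm_div, Real.norm_eq_abs, Real.norm_of_nonneg (hr0 u).le]
    exact div_le_one_of_le₀ (hru u).le (hr0 u).le
  rw [integral_add (hF.const_mul _) (hint.const_mul _), integral_const_mul, integral_const_mul,
    hodd, mul_zero, add_zero]

theorem integrable_coord_mul_rpow_neg {n : ℕ} (hn : 0 < n) (j : Fin n) {α β : ℝ}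
    (hα : 0 < α) (hβ : 0 < β) :
    Integrable fun z : En n => z j * (α * ‖z‖ ^ 2 + β) ^ (-((n : ℝ) + 1)) := by
  have hn' : (0 : ℝ) < n := by exact_mod_cast hn
  have h := integrable_mul_norm_sq_add_rpow_neg (E := En n) (p := n) hα hβ
    (by rw [finrank_euclideanSpace_fin]; linarith)
  refine Integrable.mono' (h.const_mul (α⁻¹ + β⁻¹))
    (Measurable.aestronglyMeasurable (by fun_prop)) (Eventually.of_forall fun z => ?_)
  have hz : |z j| ≤ ‖z‖ := by simpa using PiLp.norm_apply_le z j
  have hpos : 0 < α * ‖z‖ ^ 2 + β := by positivity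
  have hz' : |z j| ≤ (α⁻¹ + β⁻¹) * (α * ‖z‖ ^ 2 + β) := by
    have : (α⁻¹ + β⁻¹) * (α * ‖z‖ ^ 2 + β) =
        ‖z‖ ^ 2 + 1 + (β * α⁻¹ + α * ‖z‖ ^ 2 * β⁻¹) := by
      field_simp; ring
    have h2 : 0 ≤ β * α⁻¹ + α * ‖z‖ ^ 2 * β⁻¹ := by positivity
    rw [this]
    nlinarith [sq_nonneg (‖z‖ - 1), norm_nonneg z]
  rw [norm_mul, Real.norm_eq_abs, Real.norm_of_nonneg (by positivity),
    show -((n : ℝ) + 1) = -1 + -(n : ℝ) by ring, Real.rpow_add hpos, Real.rpow_neg_one, ← mul_assoc]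
  gcongr
  rw [← div_eq_mul_inv, div_le_iff₀ hpos]
  exact hz'

theorem integral_coord_mul_rpow_neg {n : ℕ} (j : Fin n) (α β p : ℝ) :
    ∫ z : En n, z j * (α * ‖z‖ ^ 2 + β) ^ p = 0 := by
  have h := integral_neg_eq_self (fun z : En n => z j * (α * ‖z‖ ^ 2 + β) ^ p) volume
  simp only [norm_neg, PiLp.neg_apply, neg_mul, integral_neg] at h
  linarith

theorem Gamma_mul_integral_coord_mul_rpow_neg {n : ℕ} (hn : 0 < n) (j : Fin n) (x : En n)
    {s t v : ℝ} (hs : 0 < s) (ht : 0 < t) (hv : 0 < v) :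
    Real.Gamma ((n : ℝ) + 1) *
      ∫ y : En n, y j * ((‖y‖ ^ 2 + s ^ 2) + v * (‖x - y‖ ^ 2 + t ^ 2)) ^ (-((n : ℝ) + 1)) =
    x j * Real.pi ^ ((n : ℝ) / 2) * Real.Gamma ((n : ℝ) / 2 + 1) *
      (v * (s ^ 2 / v + t ^ 2 * v + (‖x‖ ^ 2 + s ^ 2 + t ^ 2)) ^ (-((n : ℝ) / 2 + 1)) *
        v ^ (-((n : ℝ) / 2 + 1))) := by
  have hn' : (0 : ℝ) < n := by exact_mod_cast hn
  set m : ℝ := v / (1 + v) with hm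
  set D : ℝ := m * ‖x‖ ^ 2 + s ^ 2 + v * t ^ 2 with hD
  have hm0 : 0 < m := by positivity
  have hD0 : 0 < D := by positivity
  have hsq : ∀ z : En n, (‖z + m • x‖ ^ 2 + s ^ 2) + v * (‖x - (z + m • x)‖ ^ 2 + t ^ 2) =
      (1 + v) * ‖z‖ ^ 2 + D := by
    intro z
    have h1 : x - (z + m • x) = (1 - m) • x - z := by rw [sub_smul, one_smul]; abel
    rw [h1, norm_add_sq_real, norm_sub_sq_real, norm_smul, norm_smul, real_inner_smul_left,
      real_inner_smul_right, real_inner_comm, mul_pow, mul_pow, Real.norm_eq_abs,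
      Real.norm_eq_abs, sq_abs, sq_abs, hD, hm]
    field_simp
    ring
  rw [← integral_add_right_eq_self _ (m • x)]
  simp only [hsq, PiLp.add_apply, PiLp.smul_apply, smul_eq_mul, add_mul (_ : ℝ) (m * x j)]
  rw [integral_add (integrable_coord_mul_rpow_neg hn j (by positivity) hD0)
    ((integrable_mul_norm_sq_add_rpow_neg (by positivity) hD0
      (by rw [finrank_euclideanSpace_fin]; linarith)).const_mul _),
    integral_coord_mul_rpow_neg, zero_add, integral_const_mul, mul_left_comm,
    Gamma_mul_integral_mul_norm_sq_add_rpow_neg (by positivity) hD0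
      (by rw [finrank_euclideanSpace_fin]; linarith), finrank_euclideanSpace_fin,
    show (n : ℝ) / 2 - (n + 1) = -((n : ℝ) / 2 + 1) by ring,
    show (n : ℝ) + 1 - n / 2 = n / 2 + 1 by ring]
  have hS : s ^ 2 / v + t ^ 2 * v + (‖x‖ ^ 2 + s ^ 2 + t ^ 2) = D * (1 + v) * v⁻¹ := by
    rw [hD, hm]; field_simp; ring
  rw [hS, Real.mul_rpow (by positivity) (by positivity), Real.mul_rpow hD0.le (by positivity),
    Real.inv_rpow hv.le, Real.div_rpow Real.pi_pos.le (by positivity), Real.rpow_neg hv.le,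
    inv_inv, show -((n : ℝ) / 2 + 1) = -((n : ℝ) / 2) - 1 by ring,
    Real.rpow_sub_one (by positivity) (_ : ℝ) (x := 1 + v),
    Real.rpow_neg (x := 1 + v) (by positivity)]
  have : v ^ ((n : ℝ) / 2 + 1) ≠ 0 := by positivity
  rw [hm]
  field_simp

/-- The conjugate kernel `y_j / (|y|² + s²)^{(n+1)/2}`, without its normalising constant. -/
def conjK (n : ℕ) (j : Fin n) (s : ℝ) (y : En n) : ℝ :=
  y j * (‖y‖ ^ 2 + s ^ 2) ^ (-(((n : ℝ) + 1) / 2))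

theorem abs_conjK_le {n : ℕ} (j : Fin n) {s : ℝ} (hs : 0 < s) (y : En n) :
    |conjK n j s y| ≤ s ^ (-(n : ℝ)) := by
  have hy : |y j| ≤ ‖y‖ := by simpa using PiLp.norm_apply_le y j
  have hpos : 0 < ‖y‖ ^ 2 + s ^ 2 := by positivity
  have hy' : |y j| ≤ (‖y‖ ^ 2 + s ^ 2) ^ (1 / 2 : ℝ) := by
    rw [← Real.sqrt_eq_rpow]
    exact hy.trans (Real.le_sqrt_of_sq_le (by nlinarith))
  rw [conjK, abs_mul, abs_of_pos (Real.rpow_pos_of_pos hpos _)]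
  calc _ ≤ (‖y‖ ^ 2 + s ^ 2) ^ (1 / 2 : ℝ) * (‖y‖ ^ 2 + s ^ 2) ^ (-(((n : ℝ) + 1) / 2)) := by
        gcongr
    _ = (‖y‖ ^ 2 + s ^ 2) ^ (-((n : ℝ) / 2)) := by rw [← Real.rpow_add hpos]; ring_nf
    _ ≤ (s ^ 2) ^ (-((n : ℝ) / 2)) :=
        Real.rpow_le_rpow_of_nonpos (by positivity) (by nlinarith [sq_nonneg ‖y‖])
          (by have : (0 : ℝ) ≤ n := n.cast_nonneg
              linarith)
    _ = _ := by
        rw [← Real.rpow_natCast, ← Real.rpow_mul hs.le]; congr 1; push_cast; ring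

theorem measurable_conjK {n : ℕ} (j : Fin n) (s : ℝ) : Measurable (conjK n j s) := by
  unfold conjK; fun_prop

theorem integrable_norm_sub_sq_add_rpow_neg {n : ℕ} (x : En n) {t p : ℝ} (ht : 0 < t)
    (hp : (n : ℝ) / 2 < p) :
    Integrable fun y : En n => (‖x - y‖ ^ 2 + t ^ 2) ^ (-p) := by
  have h := integrable_mul_norm_sq_add_rpow_neg (E := En n) (p := p) one_pos (pow_pos ht 2)
    (by rwa [finrank_euclideanSpace_fin])
  simp only [one_mul] at h
  exact h.comp_sub_left x

theorem poisC_pos (n : ℕ) : 0 < poisC n :=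
  div_pos (Real.Gamma_pos_of_pos (by positivity)) (by positivity)

theorem poisP_eq {n : ℕ} {t : ℝ} (ht : 0 < t) (x : En n) :
    poisP n t x = poisC n * t * (‖x‖ ^ 2 + t ^ 2) ^ (-(((n : ℝ) + 1) / 2)) := by
  rw [poisP, Real.rpow_neg (by positivity), div_eq_mul_inv]

/-- The Poisson extension of the conjugate kernel at height `s` is the one at height `s + t`. -/
theorem integral_poisP_mul_conjK {n : ℕ} (hn : 0 < n) (j : Fin n) (x : En n) {s t : ℝ}
    (hs : 0 < s) (ht : 0 < t) :
    ∫ y, poisP n t (x - y) * conjK n j s y = conjK n j (s + t) x := by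
  have hn' : (1 : ℝ) ≤ n := by exact_mod_cast hn
  set a : ℝ := ((n : ℝ) + 1) / 2 with ha
  have h2a : (n : ℝ) + 1 = 2 * a := by rw [ha]; ring
  have ha1 : 1 ≤ a := by rw [ha]; linarith
  have hGa : 0 < Real.Gamma a := Real.Gamma_pos_of_pos (by linarith)
  have hG2a : 0 < Real.Gamma (2 * a) := Real.Gamma_pos_of_pos (by linarith)
  set ρ : ℝ := ‖x‖ ^ 2 + (s + t) ^ 2 with hρ
  have hρ0 : 0 < ρ := by positivity
  set q : ℝ := (n : ℝ) / 2 + 1 with hq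
  have hGq : 0 < Real.Gamma q := Real.Gamma_pos_of_pos (by positivity)
  have hF : ∀ u : ℝ, u ^ 2 + 2 * s * t + (‖x‖ ^ 2 + s ^ 2 + t ^ 2) = 1 * ‖u‖ ^ 2 + ρ := by
    intro u; rw [Real.norm_eq_abs, sq_abs, hρ]; ring
  have hfr : ((Module.finrank ℝ ℝ : ℕ) : ℝ) / 2 < q := by
    rw [Module.finrank_self, hq]; push_cast; linarith
  have hfey := fun y : En n => Gamma_mul_integral_feynman ha1
    (show 0 < ‖y‖ ^ 2 + s ^ 2 by positivity) (show 0 < ‖x - y‖ ^ 2 + t ^ 2 by positivity)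
  have hIint : Integrable fun y : En n =>
      y j * ((‖y‖ ^ 2 + s ^ 2) ^ (-a) * (‖x - y‖ ^ 2 + t ^ 2) ^ (-a)) := by
    have h := (integrable_norm_sub_sq_add_rpow_neg x (p := a) ht
      (by rw [ha]; linarith)).bdd_mul (c := s ^ (-(n : ℝ)))
      (measurable_conjK j s).aestronglyMeasurable (Eventually.of_forall (abs_conjK_le j hs))
    refine h.congr (Eventually.of_forall fun y => ?_)
    simp only [conjK]; ring
  have hswap : ∫ y : En n, ∫ v in Ioi (0 : ℝ), y j * (v ^ (a - 1) *
        ((‖y‖ ^ 2 + s ^ 2) + v * (‖x - y‖ ^ 2 + t ^ 2)) ^ (-(2 * a))) =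
      ∫ v in Ioi (0 : ℝ), ∫ y : En n, y j * (v ^ (a - 1) *
        ((‖y‖ ^ 2 + s ^ 2) + v * (‖x - y‖ ^ 2 + t ^ 2)) ^ (-(2 * a))) := by
    apply integral_integral_swap
    rw [integrable_prod_iff]
    · refine ⟨Eventually.of_forall fun y => (hfey y).1.const_mul (y j), ?_⟩
      refine (hIint.norm.const_mul (Real.Gamma a ^ 2 / Real.Gamma (2 * a))).congr
        (Eventually.of_forall fun y => ?_)
      have h1 : ∫ v in Ioi (0 : ℝ), ‖y j * (v ^ (a - 1) *
          ((‖y‖ ^ 2 + s ^ 2) + v * (‖x - y‖ ^ 2 + t ^ 2)) ^ (-(2 * a)))‖ =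
          |y j| * ∫ v in Ioi (0 : ℝ), v ^ (a - 1) *
          ((‖y‖ ^ 2 + s ^ 2) + v * (‖x - y‖ ^ 2 + t ^ 2)) ^ (-(2 * a)) := by
        rw [← integral_const_mul]
        refine setIntegral_congr_fun measurableSet_Ioi fun v hv => ?_
        have hv' : (0 : ℝ) < v := hv
        simp only
        rw [norm_mul, Real.norm_eq_abs, Real.norm_of_nonneg (by positivity)]
      simp only [Function.uncurry]
      rw [h1, norm_mul, Real.norm_eq_abs (y j),
        Real.norm_of_nonneg (by positivity)]
      rw [div_mul_eq_mul_div, div_eq_iff hG2a.ne']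
      linear_combination (-|y j|) * (hfey y).2
    · apply Measurable.aestronglyMeasurable
      simp only [Function.uncurry_def]
      fun_prop
  have hmain : Real.Gamma a ^ 2 * ∫ y : En n,
      y j * ((‖y‖ ^ 2 + s ^ 2) ^ (-a) * (‖x - y‖ ^ 2 + t ^ 2) ^ (-a)) =
      x j * Real.pi ^ a * t⁻¹ * ρ ^ (-a) * Real.Gamma a := by
    calc _ = Real.Gamma (2 * a) * ∫ y : En n, ∫ v in Ioi (0 : ℝ), y j * (v ^ (a - 1) *
          ((‖y‖ ^ 2 + s ^ 2) + v * (‖x - y‖ ^ 2 + t ^ 2)) ^ (-(2 * a))) := by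
          rw [← integral_const_mul, ← integral_const_mul]
          refine integral_congr_ae (Eventually.of_forall fun y => ?_)
          simp only [integral_const_mul]
          linear_combination (-y j) * (hfey y).2
      _ = ∫ v in Ioi (0 : ℝ), v ^ (a - 1) * (Real.Gamma (2 * a) * ∫ y : En n, y j *
          ((‖y‖ ^ 2 + s ^ 2) + v * (‖x - y‖ ^ 2 + t ^ 2)) ^ (-(2 * a))) := by
          rw [hswap, ← integral_const_mul]
          refine integral_congr_ae (Eventually.of_forall fun v => ?_)
          simp only
          rw [← integral_const_mul, ← integral_const_mul, ← integral_const_mul]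
          congr 1; ext y; ring
      _ = ∫ v in Ioi (0 : ℝ), x j * Real.pi ^ ((n : ℝ) / 2) * Real.Gamma q *
          (v ^ (-(1 / 2) : ℝ) *
            (s ^ 2 / v + t ^ 2 * v + (‖x‖ ^ 2 + s ^ 2 + t ^ 2)) ^ (-q)) := by
          refine setIntegral_congr_fun measurableSet_Ioi fun v hv => ?_
          have hv' : (0 : ℝ) < v := hv
          have h := Gamma_mul_integral_coord_mul_rpow_neg hn j x hs ht hv'
          rw [h2a] at h
          simp only
          rw [h, show (-(1 / 2) : ℝ) = (a - 1) + 1 + -q by rw [ha, hq]; ring,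
            Real.rpow_add hv', Real.rpow_add hv', Real.rpow_one]
          ring
      _ = x j * Real.pi ^ ((n : ℝ) / 2) * t⁻¹ *
          (Real.Gamma q * ∫ u : ℝ, (1 * ‖u‖ ^ 2 + ρ) ^ (-q)) := by
          rw [integral_const_mul, integral_Ioi_cauchy_schlomilch hs ht
            (F := fun r => (r + (‖x‖ ^ 2 + s ^ 2 + t ^ 2)) ^ (-q))]
          · simp only [hF]; ring
          · simp only [hF]
            exact integrable_mul_norm_sq_add_rpow_neg one_pos hρ0 hfr
      _ = _ := by
          rw [Gamma_mul_integral_mul_norm_sq_add_rpow_neg one_pos hρ0 hfr, Module.finrank_self,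
            div_one, show a = (n : ℝ) / 2 + ((1 : ℕ) : ℝ) / 2 by rw [ha]; push_cast; ring,
            Real.rpow_add Real.pi_pos]
          rw [show ((1 : ℕ) : ℝ) / 2 - q = -((n : ℝ) / 2 + ((1 : ℕ) : ℝ) / 2) by
              rw [hq]; push_cast; ring,
            show q - ((1 : ℕ) : ℝ) / 2 = (n : ℝ) / 2 + ((1 : ℕ) : ℝ) / 2 by
              rw [hq]; push_cast; ring]
          ring
  have hfin : ∫ y : En n, y j * ((‖y‖ ^ 2 + s ^ 2) ^ (-a) * (‖x - y‖ ^ 2 + t ^ 2) ^ (-a)) =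
      x j * Real.pi ^ a * t⁻¹ * ρ ^ (-a) / Real.Gamma a := by
    field_simp
    field_simp at hmain
    linear_combination hmain
  calc _ = ∫ y : En n, poisC n * t *
        (y j * ((‖y‖ ^ 2 + s ^ 2) ^ (-a) * (‖x - y‖ ^ 2 + t ^ 2) ^ (-a))) := by
        refine integral_congr_ae (Eventually.of_forall fun y => ?_)
        simp only [poisP_eq ht, conjK]; ring
    _ = _ := by
        rw [integral_const_mul, hfin, poisC, conjK, ← ha, ← hρ]
        have : Real.pi ^ a ≠ 0 := by positivity
        field_simp

/-- The time derivative of the Poisson kernel in closed form. -/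
def poisD (n : ℕ) (t : ℝ) (z : En n) : ℝ :=
  poisC n * ((‖z‖ ^ 2 + t ^ 2) ^ (-(((n : ℝ) + 1) / 2)) -
    ((n : ℝ) + 1) * t ^ 2 * (‖z‖ ^ 2 + t ^ 2) ^ (-(((n : ℝ) + 1) / 2) - 1))

theorem hasDerivAt_add_sq_rpow {b t : ℝ} (hb : 0 ≤ b) (ht : 0 < t) (p : ℝ) :
    HasDerivAt (fun s : ℝ => (b + s ^ 2) ^ p) (2 * t * p * (b + t ^ 2) ^ (p - 1)) t := by
  have h : HasDerivAt (fun s : ℝ => b + s ^ 2) (2 * t) t := by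
    simpa using (hasDerivAt_pow 2 t).const_add b
  exact h.rpow_const (Or.inl (by positivity))

theorem hasDerivAt_poisP {n : ℕ} {t : ℝ} (ht : 0 < t) (z : En n) :
    HasDerivAt (fun s : ℝ => poisP n s z) (poisD n t z) t := by
  have h := ((hasDerivAt_id t).const_mul (poisC n)).mul
    (hasDerivAt_add_sq_rpow (sq_nonneg ‖z‖) ht (-(((n : ℝ) + 1) / 2)))
  refine (h.congr_of_eventuallyEq ?_).congr_deriv ?_
  · filter_upwards [Ioi_mem_nhds ht] with s hs
    exact poisP_eq hs z
  · simp only [poisD, id]; ring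

theorem contDiff_poisD (n : ℕ) {t : ℝ} (ht : 0 < t) : ContDiff ℝ 1 (poisD n t) := by
  have h : ContDiff ℝ 1 fun z : En n => ‖z‖ ^ 2 + t ^ 2 :=
    (contDiff_norm_sq ℝ).add contDiff_const
  have hne : ∀ z : En n, ‖z‖ ^ 2 + t ^ 2 ≠ 0 := fun z => by positivity
  exact contDiff_const.mul ((h.rpow_const_of_ne hne).sub
    (contDiff_const.mul (h.rpow_const_of_ne hne)))

theorem abs_poisD_le {n : ℕ} {t : ℝ} (ht : 0 < t) (z : En n) :
    |poisD n t z| ≤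
      poisC n * ((n : ℝ) + 2) * (‖z‖ ^ 2 + t ^ 2) ^ (-(((n : ℝ) + 1) / 2)) := by
  have hpos : 0 < ‖z‖ ^ 2 + t ^ 2 := by positivity
  have h1 : 0 ≤ t ^ 2 * (‖z‖ ^ 2 + t ^ 2)⁻¹ := by positivity
  have h2 : t ^ 2 * (‖z‖ ^ 2 + t ^ 2)⁻¹ ≤ 1 := by
    rw [← div_eq_mul_inv]
    exact div_le_one_of_le₀ (by nlinarith [sq_nonneg ‖z‖]) hpos.le
  have hn : (0 : ℝ) ≤ n := n.cast_nonneg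
  rw [poisD, Real.rpow_sub_one hpos.ne', abs_mul, abs_of_pos (poisC_pos n),
    mul_assoc (poisC n) ((n : ℝ) + 2)]
  refine mul_le_mul_of_nonneg_left ?_ (poisC_pos n).le
  rw [show (‖z‖ ^ 2 + t ^ 2) ^ (-(((n : ℝ) + 1) / 2)) - ((n : ℝ) + 1) * t ^ 2 *
      ((‖z‖ ^ 2 + t ^ 2) ^ (-(((n : ℝ) + 1) / 2)) / (‖z‖ ^ 2 + t ^ 2)) =
      (1 - ((n : ℝ) + 1) * (t ^ 2 * (‖z‖ ^ 2 + t ^ 2)⁻¹)) *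
        (‖z‖ ^ 2 + t ^ 2) ^ (-(((n : ℝ) + 1) / 2)) by rw [div_eq_mul_inv]; ring,
    abs_mul, abs_of_pos (Real.rpow_pos_of_pos hpos _)]
  gcongr
  rw [abs_le]
  constructor <;> nlinarith

theorem integrable_poisD (n : ℕ) {t : ℝ} (ht : 0 < t) : Integrable (poisD n t) := by
  have h := integrable_mul_norm_sq_add_rpow_neg (E := En n) (p := ((n : ℝ) + 1) / 2) one_pos
    (pow_pos ht 2) (by rw [finrank_euclideanSpace_fin]; linarith)
  simp only [one_mul] at h
  exact (h.const_mul (poisC n * ((n : ℝ) + 2))).mono'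
    (contDiff_poisD n ht).continuous.aestronglyMeasurable
    (Eventually.of_forall fun z => abs_poisD_le ht z)

theorem integral_poisD_mul_conjK {n : ℕ} (hn : 0 < n) (j : Fin n) (x : En n) {s t : ℝ}
    (hs : 0 < s) (ht : 0 < t) :
    ∫ y, poisD n t (x - y) * conjK n j s y =
      -((n : ℝ) + 1) * (s + t) * x j *
        (‖x‖ ^ 2 + (s + t) ^ 2) ^ (-(((n : ℝ) + 1) / 2) - 1) := by
  have hmK : AEStronglyMeasurable (conjK n j s) volume :=
    (measurable_conjK j s).aestronglyMeasurable
  have hint : ∀ τ, 0 < τ → Integrable fun y : En n =>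
      (‖x - y‖ ^ 2 + τ ^ 2) ^ (-(((n : ℝ) + 1) / 2)) := fun τ hτ =>
    integrable_norm_sub_sq_add_rpow_neg x hτ (by linarith)
  have hP : ∀ τ, 0 < τ → Integrable fun y => poisP n τ (x - y) * conjK n j s y := by
    intro τ hτ
    simp only [poisP_eq hτ]
    exact ((hint τ hτ).const_mul _).mul_bdd (c := s ^ (-(n : ℝ))) hmK
      (Eventually.of_forall (abs_conjK_le j hs))
  have h1 := (hasDerivAt_integral_of_dominated_loc_of_deriv_le (μ := (volume : Measure (En n)))
    (F := fun τ y => poisP n τ (x - y) * conjK n j s y)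
    (F' := fun τ y => poisD n τ (x - y) * conjK n j s y) (x₀ := t)
    (bound := fun y => poisC n * ((n : ℝ) + 2) *
      (‖x - y‖ ^ 2 + (t / 2) ^ 2) ^ (-(((n : ℝ) + 1) / 2)) * s ^ (-(n : ℝ)))
    (Ioi_mem_nhds (half_lt_self ht)) ?_ (hP t ht) ?_ ?_
    (((hint _ (half_pos ht)).const_mul _).mul_const _) ?_).2
  · have h2 : HasDerivAt (fun τ => ∫ y, poisP n τ (x - y) * conjK n j s y)
        (x j * (2 * (s + t) * (-(((n : ℝ) + 1) / 2)) *
          (‖x‖ ^ 2 + (s + t) ^ 2) ^ (-(((n : ℝ) + 1) / 2) - 1))) t := by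
      have h3 := ((hasDerivAt_add_sq_rpow (sq_nonneg ‖x‖) (add_pos hs ht)
        (-(((n : ℝ) + 1) / 2))).comp_const_add s t).const_mul (x j)
      refine h3.congr_of_eventuallyEq ?_
      filter_upwards [Ioi_mem_nhds ht] with τ hτ
      exact integral_poisP_mul_conjK hn j x hs hτ
    rw [h1.unique h2]
    ring
  · filter_upwards [Ioi_mem_nhds ht] with τ hτ using (hP τ hτ).aestronglyMeasurable
  · exact ((contDiff_poisD n ht).continuous.comp
      (continuous_const.sub continuous_id)).aestronglyMeasurable.mul hmK
  · refine Eventually.of_forall fun y τ hτ => ?_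
    have hτ' : t / 2 < τ := hτ
    have ht2 : 0 < t / 2 := half_pos ht
    have hτ0 : 0 < τ := ht2.trans hτ'
    rw [norm_mul]
    refine mul_le_mul ((abs_poisD_le hτ0 _).trans ?_) (abs_conjK_le j hs y) (norm_nonneg _) ?_
    · refine mul_le_mul_of_nonneg_left ?_ (mul_nonneg (poisC_pos n).le (by positivity))
      refine Real.rpow_le_rpow_of_nonpos (by positivity) (by gcongr) ?_
      have : (0 : ℝ) ≤ n := n.cast_nonneg
      linarith
    · have := poisC_pos n
      positivity
  · refine Eventually.of_forall fun y τ hτ => ?_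
    exact (hasDerivAt_poisP ((half_pos ht).trans hτ) _).mul_const _

theorem pd1_poisP {n : ℕ} (j : Fin n) {t : ℝ} (ht : 0 < t) (x : En n) :
    pd1 n j (poisP n t) x = poisC n * (-((n : ℝ) + 1) * t * x j *
      (‖x‖ ^ 2 + t ^ 2) ^ (-(((n : ℝ) + 1) / 2) - 1)) := by
  have h1 : HasFDerivAt (fun z : En n => ‖z‖ ^ 2 + t ^ 2) (2 • innerSL ℝ x) x :=
    (hasStrictFDerivAt_norm_sq x).hasFDerivAt.add_const _
  have h2 := (h1.rpow_const (p := -(((n : ℝ) + 1) / 2))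
    (Or.inl (by positivity))).const_mul (poisC n * t)
  rw [pd1, show poisP n t = _ from funext (poisP_eq ht), h2.fderiv]
  simp [EuclideanSpace.inner_single_right]
  ring

theorem integral_mul_odd_kernel {E : Type*} [NormedAddCommGroup E] [InnerProductSpace ℝ E]
    [FiniteDimensional ℝ E] [MeasurableSpace E] [BorelSpace E] {g k : E → ℝ} (x : E)
    (hg : Integrable g) (hk : Measurable k) {C : ℝ} (hC : ∀ y, |k y| ≤ C)
    (hodd : ∀ y, k (-y) = -k y) :
    ∫ y, g (x - y) * k y = ∫ y, (g (x - y) - g (x + y)) / 2 * k y := by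
  have h1 : Integrable fun y => g (x - y) * k y :=
    (hg.comp_sub_left x).mul_bdd hk.aestronglyMeasurable (Eventually.of_forall hC)
  have h2 : Integrable fun y => g (x + y) * k y :=
    (hg.comp_add_left x).mul_bdd hk.aestronglyMeasurable (Eventually.of_forall hC)
  have h3 := integral_neg_eq_self (fun y => g (x - y) * k y) volume
  simp only [sub_neg_eq_add, hodd, mul_neg, integral_neg] at h3
  have h4 : ∀ y, (g (x - y) - g (x + y)) / 2 * k y =
      2⁻¹ * (g (x - y) * k y) - 2⁻¹ * (g (x + y) * k y) := fun y => by ring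
  simp only [h4]
  rw [integral_sub (h1.const_mul _) (h2.const_mul _), integral_const_mul, integral_const_mul]
  linarith

/-- The Riesz kernel without its normalising constant. -/
def rieszK (n : ℕ) (j : Fin n) (y : En n) : ℝ := y j / ‖y‖ ^ ((n : ℝ) + 1)

theorem measurable_rieszK {n : ℕ} (j : Fin n) : Measurable (rieszK n j) := by
  unfold rieszK; fun_prop

theorem abs_rieszK_le {n : ℕ} (j : Fin n) {y : En n} (hy : y ≠ 0) :
    |rieszK n j y| ≤ ‖y‖ ^ (-(n : ℝ)) := by
  have hy' : |y j| ≤ ‖y‖ := by simpa using PiLp.norm_apply_le y j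
  have hpos : 0 < ‖y‖ := norm_pos_iff.2 hy
  rw [rieszK, abs_div, abs_of_pos (Real.rpow_pos_of_pos hpos _), div_le_iff₀ (by positivity),
    ← Real.rpow_add hpos]
  simpa using hy'

theorem integrable_symm_diff_mul_rieszK {n : ℕ} (hn : 0 < n) (j : Fin n) (x : En n)
    {g : En n → ℝ} (hg : Integrable g) (hg' : ContDiffAt ℝ 1 g x) :
    Integrable fun y => (g (x - y) - g (x + y)) / 2 * rieszK n j y := by
  have : Nonempty (Fin n) := ⟨j⟩
  have : Nontrivial (En n) := inferInstance
  have hh : Integrable fun y => (g (x - y) - g (x + y)) / 2 :=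
    ((hg.comp_sub_left x).sub (hg.comp_add_left x)).div_const 2
  have hmeas : AEStronglyMeasurable (fun y => (g (x - y) - g (x + y)) / 2 * rieszK n j y)
      volume := hh.aestronglyMeasurable.mul (measurable_rieszK j).aestronglyMeasurable
  obtain ⟨C, u, hu, hC⟩ := hg'.exists_lipschitzOnWith
  obtain ⟨δ, hδ, hball⟩ := Metric.mem_nhds_iff.1 hu
  have hlip : ∀ y ∈ Metric.ball (0 : En n) δ, |(g (x - y) - g (x + y)) / 2| ≤ C * ‖y‖ := by
    intro y hy
    rw [mem_ball_zero_iff] at hy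
    have h := hC.dist_le_mul (x - y) (hball (by simpa [dist_eq_norm] using hy)) (x + y)
      (hball (by simpa [dist_eq_norm] using hy))
    rw [Real.dist_eq, dist_eq_norm, show x - y - (x + y) = (-2 : ℝ) • y by
      rw [neg_smul, two_smul]; abel, norm_smul] at h
    rw [abs_div, abs_two]
    norm_num at h
    linarith
  rw [← integrableOn_univ, ← union_compl_self (Metric.ball (0 : En n) δ)]
  refine IntegrableOn.union ?_ ?_
  · have hr : IntegrableOn (fun y : En n => C * ‖y‖ ^ (1 - (n : ℝ))) (Metric.ball 0 δ) := by
      refine Integrable.const_mul ?_ _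
      rw [← IntegrableOn, integrableOn_fun_norm_addHaar volume (f := fun r : ℝ => r ^ (1 - (n : ℝ))),
        finrank_euclideanSpace_fin]
      refine (integrableOn_const (C := (1 : ℝ)) (by simp)).congr_fun (fun r hr => ?_)
        measurableSet_Ioo
      rw [smul_eq_mul, ← Real.rpow_natCast, ← Real.rpow_add hr.1, Nat.cast_sub hn]
      simp
    refine Integrable.mono' hr hmeas.restrict ?_
    filter_upwards [ae_restrict_mem measurableSet_ball,
      ae_restrict_of_ae (Measure.ae_ne volume (0 : En n))] with y hy hy0
    have hpos : 0 < ‖y‖ := norm_pos_iff.2 hy0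
    rw [norm_mul, sub_eq_add_neg (1 : ℝ) (n : ℝ), Real.rpow_add hpos, Real.rpow_one, ← mul_assoc]
    exact mul_le_mul (hlip y hy) (abs_rieszK_le j hy0) (norm_nonneg _) (by positivity)
  · refine Integrable.mul_bdd (c := δ ^ (-(n : ℝ))) hh.integrableOn
      (measurable_rieszK j).aestronglyMeasurable ?_
    filter_upwards [ae_restrict_mem measurableSet_ball.compl] with y hy
    have hy' : δ ≤ ‖y‖ := by simpa using hy
    refine (abs_rieszK_le j (norm_pos_iff.1 (hδ.trans_le hy'))).trans ?_
    exact Real.rpow_le_rpow_of_nonpos hδ hy' (by simp)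

/-- Bounded odd truncations or regularisations of the Riesz kernel all produce the same limit. -/
theorem tendsto_integral_mul_odd_kernel {n : ℕ} (hn : 0 < n) (j : Fin n) (x : En n)
    {g : En n → ℝ} (hg : Integrable g) (hg' : ContDiffAt ℝ 1 g x) {l : Filter ℝ}
    [l.IsCountablyGenerated] {k : ℝ → En n → ℝ} (hk : ∀ᶠ ε in l, Measurable (k ε) ∧
      (∃ C, ∀ y, |k ε y| ≤ C) ∧ (∀ y, k ε (-y) = -k ε y) ∧ ∀ y, |k ε y| ≤ |rieszK n j y|)
    (hlim : ∀ y ≠ 0, Tendsto (fun ε => k ε y) l (𝓝 (rieszK n j y))) :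
    Tendsto (fun ε => ∫ y, g (x - y) * k ε y) l
      (𝓝 (∫ y, (g (x - y) - g (x + y)) / 2 * rieszK n j y)) := by
  have : Nonempty (Fin n) := ⟨j⟩
  have : Nontrivial (En n) := inferInstance
  have hh : Integrable fun y => (g (x - y) - g (x + y)) / 2 :=
    ((hg.comp_sub_left x).sub (hg.comp_add_left x)).div_const 2
  refine Tendsto.congr' (f₁ := fun ε => ∫ y, (g (x - y) - g (x + y)) / 2 * k ε y) ?_ ?_
  · filter_upwards [hk] with ε hε
    obtain ⟨h1, ⟨C, h2⟩, h3, -⟩ := hε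
    exact (integral_mul_odd_kernel x hg h1 h2 h3).symm
  · refine tendsto_integral_filter_of_dominated_convergence _ ?_ ?_
      (integrable_symm_diff_mul_rieszK hn j x hg hg').norm ?_
    · filter_upwards [hk] with ε hε
      exact hh.aestronglyMeasurable.mul hε.1.aestronglyMeasurable
    · filter_upwards [hk] with ε hε
      refine Eventually.of_forall fun y => ?_
      rw [norm_mul, norm_mul]
      exact mul_le_mul_of_nonneg_left (hε.2.2.2 y) (norm_nonneg _)
    · filter_upwards [Measure.ae_ne volume (0 : En n)] with y hy
      exact (hlim y hy).const_mul _

theorem rieszK_eq_rpow {n : ℕ} (j : Fin n) (y : En n) :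
    rieszK n j y = y j * (‖y‖ ^ 2) ^ (-(((n : ℝ) + 1) / 2)) := by
  rw [rieszK, div_eq_mul_inv, ← Real.rpow_neg (norm_nonneg y), ← Real.rpow_natCast,
    ← Real.rpow_mul (norm_nonneg y)]
  congr 2
  push_cast; ring

/-- Proposition `proposition riesz even`: for `t > 0` and
`j ∈ {1,…,n}`, the Riesz transform of `∂P_t/∂t` equals `∂P_t/∂x_j`:
`lim_{ε→0⁺} c_n ∫_{|y|>ε} (∂P_t/∂t)(x-y) y_j/|y|^{n+1} dy = (∂P_t/∂x_j)(x)`. -/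
theorem riesz_of_poisson_time_derivative (n : ℕ) (hn : 0 < n) (j : Fin n)
    (t : ℝ) (ht : 0 < t) (x : En n) :
    Tendsto (fun ε : ℝ =>
        poisC n * ∫ y in {y : En n | ε < ‖y‖},
          deriv (fun s : ℝ => poisP n s (x - y)) t * (y j / ‖y‖ ^ ((n : ℝ) + 1)))
      (𝓝[>] 0) (𝓝 (pd1 n j (poisP n t) x)) := by
  have hcd := (contDiff_poisD n ht).contDiffAt (x := x)
  have hgi := integrable_poisD n ht
  have hreg : Tendsto (fun s : ℝ => ∫ y, poisD n t (x - y) * conjK n j s y) (𝓝[>] 0)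
      (𝓝 (∫ y, (poisD n t (x - y) - poisD n t (x + y)) / 2 * rieszK n j y)) := by
    refine tendsto_integral_mul_odd_kernel hn j x hgi hcd ?_ fun y hy => ?_
    · filter_upwards [self_mem_nhdsWithin] with s hs
      refine ⟨measurable_conjK j s, ⟨_, abs_conjK_le j hs⟩, fun y => by simp [conjK], fun y => ?_⟩
      rcases eq_or_ne y 0 with rfl | hy
      · simp [conjK]
      · have hpos : 0 < ‖y‖ := norm_pos_iff.2 hy
        rw [rieszK_eq_rpow, conjK, abs_mul, abs_mul,
          abs_of_pos (Real.rpow_pos_of_pos (show 0 < ‖y‖ ^ 2 + s ^ 2 by positivity) _),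
          abs_of_pos (Real.rpow_pos_of_pos (show 0 < ‖y‖ ^ 2 by positivity) _)]
        refine mul_le_mul_of_nonneg_left ?_ (abs_nonneg _)
        refine Real.rpow_le_rpow_of_nonpos (by positivity) (by nlinarith [sq_nonneg s]) ?_
        have : (0 : ℝ) ≤ n := n.cast_nonneg
        linarith
    · have hpos : 0 < ‖y‖ := norm_pos_iff.2 hy
      have h : ContinuousAt (fun s : ℝ => conjK n j s y) 0 := by
        unfold conjK
        refine ContinuousAt.mul continuousAt_const (ContinuousAt.rpow_const (by fun_prop) ?_)
        exact Or.inl (by positivity)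
      have h' := h.tendsto.mono_left (nhdsWithin_le_nhds (s := Ioi 0))
      rw [rieszK_eq_rpow]
      simpa [conjK] using h'
  have hpv : Tendsto (fun ε : ℝ => ∫ y, poisD n t (x - y) *
      {y : En n | ε < ‖y‖}.indicator (rieszK n j) y) (𝓝[>] 0)
      (𝓝 (∫ y, (poisD n t (x - y) - poisD n t (x + y)) / 2 * rieszK n j y)) := by
    have hms : ∀ ε : ℝ, MeasurableSet {y : En n | ε < ‖y‖} := fun ε =>
      measurableSet_lt measurable_const measurable_norm
    refine tendsto_integral_mul_odd_kernel hn j x hgi hcd ?_ fun y hy => ?_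
    · filter_upwards [self_mem_nhdsWithin] with ε hε
      have hε' : 0 < ε := hε
      refine ⟨(measurable_rieszK j).indicator (hms ε), ⟨ε ^ (-(n : ℝ)), fun y => ?_⟩,
        fun y => ?_, fun y => ?_⟩
      · by_cases h : ε < ‖y‖
        · rw [indicator_of_mem (show y ∈ {y : En n | ε < ‖y‖} from h)]
          exact (abs_rieszK_le j (norm_pos_iff.1 (hε'.trans h))).trans
            (Real.rpow_le_rpow_of_nonpos hε' h.le (by simp))
        · rw [indicator_of_notMem (show y ∉ {y : En n | ε < ‖y‖} from h), abs_zero]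
          positivity
      · by_cases h : ε < ‖y‖ <;> simp [indicator, h, rieszK, neg_div]
      · by_cases h : ε < ‖y‖ <;> simp [indicator, h]
    · refine tendsto_const_nhds.congr' ?_
      filter_upwards [nhdsWithin_le_nhds (Iio_mem_nhds (norm_pos_iff.2 hy))] with ε hε
      exact (indicator_of_mem (show y ∈ {y : En n | ε < ‖y‖} from hε) _).symm
  have hval : Tendsto (fun s : ℝ => ∫ y, poisD n t (x - y) * conjK n j s y) (𝓝[>] 0)
      (𝓝 (-((n : ℝ) + 1) * t * x j * (‖x‖ ^ 2 + t ^ 2) ^ (-(((n : ℝ) + 1) / 2) - 1))) := by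
    have h : ContinuousAt (fun s : ℝ => -((n : ℝ) + 1) * (s + t) * x j *
        (‖x‖ ^ 2 + (s + t) ^ 2) ^ (-(((n : ℝ) + 1) / 2) - 1)) 0 := by
      refine ContinuousAt.mul (by fun_prop) (ContinuousAt.rpow_const (by fun_prop) ?_)
      exact Or.inl (by positivity)
    have h' := h.tendsto.mono_left (nhdsWithin_le_nhds (s := Ioi 0))
    rw [zero_add] at h'
    refine h'.congr' ?_
    filter_upwards [self_mem_nhdsWithin] with s hs
    exact (integral_poisD_mul_conjK hn j x hs ht).symm
  rw [pd1_poisP j ht, ← tendsto_nhds_unique hreg hval]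
  refine (hpv.const_mul (poisC n)).congr fun ε => ?_
  rw [← integral_indicator (measurableSet_lt measurable_const measurable_norm)]
  congr 2
  ext y
  by_cases h : ε < ‖y‖ <;> simp [indicator, h, (hasDerivAt_poisP ht (x - y)).deriv, rieszK]

end
end

section
/- Let n ∈ ℕ and let f := χ_{[0,1]^n} be the characteristic function of the unit cube [0,1]^n ⊂ ℝⁿ. Then the B^{1,1} seminorm of f is infinite: ∫_{ℝⁿ} ∫_{ℝⁿ} |f(x+h) − 2f(x) + f(x−h)| / |h|^{n+1} dx dh = +∞. In particular, f ∈ BV(ℝⁿ) but f ∉ B^{1,1}(ℝⁿ), so there is no constant C with ‖g‖_{B^{1,1}(ℝⁿ)} ≤ C(‖g‖_{L¹(ℝⁿ)} + |Dg|(ℝⁿ)) for all g ∈ BV(ℝⁿ). -/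
open MeasureTheory Filter Set
open scoped ENNReal NNReal Topology

noncomputable section

theorem EuclideanSpace.volume_setOf_forall_mem {n : ℕ} (s : Fin n → Set ℝ) :
    volume {x : En n | ∀ i, x i ∈ s i} = ∏ i, volume (s i) := by
  have h := (EuclideanSpace.volume_preserving_symm_measurableEquiv_toLp
    (Fin n)).measure_preimage_equiv (Set.univ.pi s)
  rw [volume_pi_pi] at h
  rw [← h]
  congr 1
  ext x
  simp [Set.mem_pi]

theorem EuclideanSpace.measurableSet_setOf_forall_mem {n : ℕ} {s : Fin n → Set ℝ}
    (hs : ∀ i, MeasurableSet (s i)) : MeasurableSet {x : En n | ∀ i, x i ∈ s i} := by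
  rw [Set.ofPred_forall]
  exact MeasurableSet.iInter fun i =>
    (hs i).preimage (EuclideanSpace.proj (𝕜 := ℝ) i).continuous.measurable

theorem EuclideanSpace.norm_le_card_mul {n : ℕ} {x : En n} {c : ℝ} (h : ∀ i, |x i| ≤ c) :
    ‖x‖ ≤ n * c := by
  calc ‖x‖ = ‖∑ i, EuclideanSpace.single i (x i)‖ := by
        congr 1
        ext j
        simp [Pi.single_apply]
    _ ≤ ∑ i, ‖EuclideanSpace.single i (x i)‖ := norm_sum_le _ _
    _ ≤ ∑ _i : Fin n, c := Finset.sum_le_sum fun i _ => by simpa using h i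
    _ = n * c := by simp

/-- The indicator function of the unit cube. -/
def cubeIndicator (n : ℕ) : En n → ℝ :=
  ({x : En n | ∀ i, x i ∈ Set.Icc (0 : ℝ) 1}).indicator (fun _ => (1 : ℝ))

/-- The integrand of the second order Besov seminorm of the unit cube. -/
def cubeBesovIntegrand (n : ℕ) (h x : En n) : ℝ≥0∞ :=
  ENNReal.ofReal (|cubeIndicator n (x + h) - 2 * cubeIndicator n x + cubeIndicator n (x - h)| /
    ‖h‖ ^ ((n : ℝ) + 1))

/-- The part of the unit cube within distance `r` of the face `x i₀ = 0` and at distance `1 / 2`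
from the opposite faces. -/
def cubeFaceLayer {n : ℕ} (i₀ : Fin n) (r : ℝ) : Set (En n) :=
  {x | ∀ i, x i ∈ Set.Icc 0 (if i = i₀ then r else 1 / 2)}

theorem volume_cubeFaceLayer {n : ℕ} (i₀ : Fin n) {r : ℝ} (hr : 0 ≤ r) :
    volume (cubeFaceLayer i₀ r) = ENNReal.ofReal (r * (1 / 2) ^ (n - 1)) := by
  rw [cubeFaceLayer, EuclideanSpace.volume_setOf_forall_mem]
  simp only [Real.volume_Icc, sub_zero]
  rw [← ENNReal.ofReal_prod_of_nonneg fun i _ => by split_ifs <;> positivity]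
  rw [← Finset.mul_prod_erase _ _ (Finset.mem_univ i₀), if_pos rfl]
  rw [Finset.prod_congr rfl fun i hi => if_neg (Finset.ne_of_mem_erase hi)]
  simp

/-- The open box `(r, 2r)ⁿ`. -/
def dyadicBox (n : ℕ) (r : ℝ) : Set (En n) := {h | ∀ i, h i ∈ Set.Ioo r (2 * r)}

theorem volume_dyadicBox (n : ℕ) {r : ℝ} (hr : 0 ≤ r) :
    volume (dyadicBox n r) = ENNReal.ofReal (r ^ n) := by
  rw [dyadicBox, EuclideanSpace.volume_setOf_forall_mem]
  simp [Real.volume_Ioo, two_mul, ENNReal.ofReal_pow hr]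

theorem measurableSet_dyadicBox (n : ℕ) (r : ℝ) : MeasurableSet (dyadicBox n r) :=
  EuclideanSpace.measurableSet_setOf_forall_mem fun _ => measurableSet_Ioo

theorem le_cubeBesovIntegrand {n : ℕ} (i₀ : Fin n) {r : ℝ} (hr : 0 < r) (hr' : r ≤ 1 / 4)
    {h x : En n} (hh : h ∈ dyadicBox n r) (hx : x ∈ cubeFaceLayer i₀ r) :
    ENNReal.ofReal (1 / (n * (2 * r)) ^ (n + 1)) ≤ cubeBesovIntegrand n h x := by
  have hx' : ∀ i, 0 ≤ x i ∧ x i ≤ 1 / 2 := fun i => by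
    have := hx i
    refine ⟨this.1, this.2.trans ?_⟩
    split_ifs <;> linarith
  have hx₀ : x i₀ ≤ r := by simpa using (hx i₀).2
  have h1 : cubeIndicator n (x + h) = 1 := Set.indicator_of_mem (fun i => by
    have := hh i
    have := hx' i
    simp only [PiLp.add_apply, Set.mem_Icc, Set.mem_Ioo] at *
    constructor <;> linarith) _
  have h2 : cubeIndicator n x = 1 := Set.indicator_of_mem (fun i => by
    have := hx' i
    simp only [Set.mem_Icc]
    constructor <;> linarith) _
  have h3 : cubeIndicator n (x - h) = 0 := Set.indicator_of_notMem (fun hmem => by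
    have h4 := (hmem i₀).1
    have h5 := (hh i₀).1
    simp only [PiLp.sub_apply] at h4
    linarith) _
  have hnorm : ‖h‖ ≤ n * (2 * r) := EuclideanSpace.norm_le_card_mul fun i => by
    have := hh i
    rw [abs_of_pos (hr.trans this.1)]
    exact this.2.le
  have hpos : 0 < ‖h‖ := norm_pos_iff.2 fun h0 => by
    have := (hh i₀).1
    simp only [h0, PiLp.zero_apply] at this
    linarith
  rw [cubeBesovIntegrand, h1, h2, h3]
  have hexp : (n : ℝ) + 1 = ((n + 1 : ℕ) : ℝ) := by push_cast; ring
  rw [hexp, Real.rpow_natCast]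
  apply ENNReal.ofReal_le_ofReal
  norm_num only [abs_neg, abs_one]
  gcongr

theorem le_setLIntegral_dyadicBox {n : ℕ} (i₀ : Fin n) {r : ℝ} (hr : 0 < r) (hr' : r ≤ 1 / 4) :
    ENNReal.ofReal ((1 / 2) ^ (n - 1) / (2 * n) ^ (n + 1)) ≤
      ∫⁻ h in dyadicBox n r, ∫⁻ x, cubeBesovIntegrand n h x := by
  have hn : (0 : ℝ) < n := by exact_mod_cast i₀.pos
  set c := ENNReal.ofReal (1 / (n * (2 * r)) ^ (n + 1))
  have hinner : ∀ h ∈ dyadicBox n r,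
      c * volume (cubeFaceLayer i₀ r) ≤ ∫⁻ x, cubeBesovIntegrand n h x := fun h hh =>
    calc c * volume (cubeFaceLayer i₀ r) = ∫⁻ _ in cubeFaceLayer i₀ r, c :=
          (setLIntegral_const _ _).symm
      _ ≤ ∫⁻ x in cubeFaceLayer i₀ r, cubeBesovIntegrand n h x :=
          setLIntegral_mono' (EuclideanSpace.measurableSet_setOf_forall_mem
            fun _ => measurableSet_Icc) fun x hx => le_cubeBesovIntegrand i₀ hr hr' hh hx
      _ ≤ ∫⁻ x, cubeBesovIntegrand n h x := setLIntegral_le_lintegral _ _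
  calc ENNReal.ofReal ((1 / 2) ^ (n - 1) / (2 * n) ^ (n + 1))
      = c * volume (cubeFaceLayer i₀ r) * volume (dyadicBox n r) := by
        rw [volume_cubeFaceLayer i₀ hr.le, volume_dyadicBox n hr.le,
          ← ENNReal.ofReal_mul (by positivity), ← ENNReal.ofReal_mul (by positivity)]
        congr 1
        field_simp
        ring
    _ = ∫⁻ _ in dyadicBox n r, c * volume (cubeFaceLayer i₀ r) :=
        (setLIntegral_const _ _).symm
    _ ≤ _ := setLIntegral_mono' (measurableSet_dyadicBox n r) hinner

theorem pairwise_disjoint_dyadicBox {n : ℕ} (i₀ : Fin n) :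
    Pairwise (Function.onFun Disjoint fun k : ℕ => dyadicBox n ((1 / 2) ^ (k + 2))) := by
  refine (pairwise_disjoint_on _).2 fun k l hkl => Set.disjoint_left.2 fun h hk hl => ?_
  have h1 := (hk i₀).1
  have h2 := (hl i₀).2
  have h3 : (1 / 2 : ℝ) ^ (l + 2) ≤ (1 / 2) ^ (k + 2 + 1) :=
    pow_le_pow_of_le_one (by norm_num) (by norm_num) (by omega)
  rw [pow_succ _ (k + 2)] at h3
  linarith

theorem lintegral_cubeBesovIntegrand {n : ℕ} (hn : 0 < n) :
    ∫⁻ h, ∫⁻ x, cubeBesovIntegrand n h x = ⊤ := by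
  have hn' : (0 : ℝ) < n := by exact_mod_cast hn
  let i₀ : Fin n := ⟨0, hn⟩
  refine top_le_iff.1 ?_
  calc (⊤ : ℝ≥0∞) = ∑' _ : ℕ, ENNReal.ofReal ((1 / 2) ^ (n - 1) / (2 * n) ^ (n + 1)) :=
        (ENNReal.tsum_const_eq_top_of_ne_zero
          (ENNReal.ofReal_pos.2 (by positivity)).ne').symm
    _ ≤ ∑' k : ℕ, ∫⁻ h in dyadicBox n ((1 / 2) ^ (k + 2)), ∫⁻ x, cubeBesovIntegrand n h x := by
        refine ENNReal.tsum_le_tsum fun k => le_setLIntegral_dyadicBox i₀ (by positivity) ?_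
        calc (1 / 2 : ℝ) ^ (k + 2) ≤ (1 / 2) ^ 2 :=
              pow_le_pow_of_le_one (by norm_num) (by norm_num) (by omega)
          _ = 1 / 4 := by norm_num
    _ = ∫⁻ h in ⋃ k : ℕ, dyadicBox n ((1 / 2) ^ (k + 2)), ∫⁻ x, cubeBesovIntegrand n h x :=
        (lintegral_iUnion (fun _ => measurableSet_dyadicBox n _)
          (pairwise_disjoint_dyadicBox i₀) _).symm
    _ ≤ _ := setLIntegral_le_lintegral _ _

theorem integrable_cubeIndicator (n : ℕ) : Integrable (cubeIndicator n) := by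
  refine (integrable_indicator_iff (EuclideanSpace.measurableSet_setOf_forall_mem
    fun _ => measurableSet_Icc)).2 (integrableOn_const ?_)
  rw [EuclideanSpace.volume_setOf_forall_mem fun _ => Set.Icc (0 : ℝ) 1]
  simp

/-- the characteristic function `f = χ_{[0,1]^n}` belongs to
`L¹(ℝⁿ)` (it is a `BV` function) but its `B^{1,1}` seminorm
`∫∫ |f(x+h) - 2f(x) + f(x-h)|/|h|^{n+1} dx dh` is infinite, so `f ∉ B^{1,1}(ℝⁿ)`. -/
theorem cube_indicator_not_B11 (n : ℕ) (hn : 0 < n) :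
    Integrable (({x : En n | ∀ i, x i ∈ Set.Icc (0 : ℝ) 1}).indicator
      (fun _ => (1 : ℝ))) ∧
    (∫⁻ h : En n, ∫⁻ x : En n,
        ENNReal.ofReal
          (|({x : En n | ∀ i, x i ∈ Set.Icc (0 : ℝ) 1}).indicator
              (fun _ => (1 : ℝ)) (x + h) -
            2 * ({x : En n | ∀ i, x i ∈ Set.Icc (0 : ℝ) 1}).indicator
              (fun _ => (1 : ℝ)) x +
            ({x : En n | ∀ i, x i ∈ Set.Icc (0 : ℝ) 1}).indicator
              (fun _ => (1 : ℝ)) (x - h)| / ‖h‖ ^ ((n : ℝ) + 1))) = ⊤ :=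
  ⟨integrable_cubeIndicator n, lintegral_cubeBesovIntegrand hn⟩


end
end
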